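/- Every pre-tabular normal modal logic containing S4 and every pre-tabular normal modal logic containing GL has both the poly-size model property and the exponential growth property. -/

import Mathlib

inductive MForm (α : Type) : Type
  | top : MForm α
  | atom : α → MForm α
  | neg : MForm α → MForm α
  | and : MForm α → MForm α → MForm α
  | box : MForm α → MForm α
deriving DecidableEq

namespace MForm

def imp {α : Type} (φ ψ : MForm α) : MForm α := neg (and φ (neg ψ))

def dia {α : Type} (φ : MForm α) : MForm α := neg (box (neg φ))

def sig {α : Type} [DecidableEq α] : MForm α → Finset α
  | top => ∅
  | atom p => {p}
  | neg φ => sig φ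
  | and φ ψ => sig φ ∪ sig ψ
  | box φ => sig φ

def IsProp {α : Type} : MForm α → Prop
  | top => True
  | atom _ => True
  | neg φ => IsProp φ
  | and φ ψ => IsProp φ ∧ IsProp ψ
  | box _ => False

def subf {α : Type} [DecidableEq α] : MForm α → Finset (MForm α)
  | top => {top}
  | atom p => {atom p}
  | neg φ => insert (neg φ) (subf φ)
  | and φ ψ => insert (and φ ψ) (subf φ ∪ subf ψ)
  | box φ => insert (box φ) (subf φ)

/-- The dag-size of a formula: the number of its distinct subformulas. -/
def dagSize {α : Type} [DecidableEq α] (φ : MForm α) : ℕ := (subf φ).card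

end MForm

def psat {α : Type} (v : α → Prop) : MForm α → Prop
  | .top => True
  | .atom p => v p
  | .neg φ => ¬ psat v φ
  | .and φ ψ => psat v φ ∧ psat v ψ
  | .box _ => True

/-- Propositional tautology. -/
def PTaut {α : Type} (φ : MForm α) : Prop := ∀ v : α → Prop, psat v φ

def bigAnd {α : Type} : List (MForm α) → MForm α
  | [] => .top
  | φ :: l => .and φ (bigAnd l)

def bigOr {α : Type} (l : List (MForm α)) : MForm α := .neg (bigAnd (l.map .neg))

def boxIter {α : Type} : ℕ → MForm α → MForm α
  | 0, φ => φ
  | n + 1, φ => .box (boxIter n φ)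

def diaIter {α : Type} : ℕ → MForm α → MForm α
  | 0, φ => φ
  | n + 1, φ => MForm.dia (diaIter n φ)

/-- `□^{≤n} φ`. -/
def ble {α : Type} (n : ℕ) (φ : MForm α) : MForm α :=
  bigAnd ((List.range (n + 1)).map (fun k => boxIter k φ))

/-- `◇^{≤n} φ`. -/
def dle {α : Type} (n : ℕ) (φ : MForm α) : MForm α := .neg (ble n (.neg φ))

def substAtoms {α β : Type} (s : α → MForm β) : MForm α → MForm β
  | .top => .top
  | .atom a => s a
  | .neg φ => .neg (substAtoms s φ)
  | .and φ ψ => .and (substAtoms s φ) (substAtoms s ψ)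
  | .box φ => .box (substAtoms s φ)

structure Frame where
  W : Type
  ne : Nonempty W
  R : W → W → Prop

structure PFrame extends Frame where
  pt : W

def sat (F : Frame) (V : F.W → ℕ → Prop) : F.W → MForm ℕ → Prop
  | w, .top => True
  | w, .atom p => V w p
  | w, .neg φ => ¬ sat F V w φ
  | w, .and φ ψ => sat F V w φ ∧ sat F V w ψ
  | w, .box φ => ∀ v, F.R w v → sat F V v φ

def validAt (F : Frame) (w : F.W) (φ : MForm ℕ) : Prop := ∀ V, sat F V w φ

def Log (𝓕 : Set PFrame) : Set (MForm ℕ) := {φ | ∀ P ∈ 𝓕, validAt P.toFrame P.pt φ}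

def Rooted (F : Frame) (w : F.W) : Prop := ∀ v, Relation.ReflTransGen F.R w v

def StrImp (L : Set (MForm ℕ)) (σ : Finset ℕ) (φ χ : MForm ℕ) : Prop :=
  χ.sig ⊆ σ ∧ φ.imp χ ∈ L ∧
    ∀ ψ : MForm ℕ, ψ.sig ⊆ σ → φ.imp ψ ∈ L → χ.imp ψ ∈ L

def UnifInt (L : Set (MForm ℕ)) (σ : Finset ℕ) (φ χ : MForm ℕ) : Prop :=
  χ.sig ⊆ σ ∧ φ.imp χ ∈ L ∧
    ∀ ψ : MForm ℕ, ψ.sig ∩ φ.sig ⊆ σ → φ.imp ψ ∈ L → χ.imp ψ ∈ L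

def CraigInt (L : Set (MForm ℕ)) (φ ψ χ : MForm ℕ) : Prop :=
  φ.imp χ ∈ L ∧ χ.imp ψ ∈ L ∧ χ.sig ⊆ φ.sig ∩ ψ.sig

def HasCIP (L : Set (MForm ℕ)) : Prop :=
  ∀ φ ψ : MForm ℕ, φ.imp ψ ∈ L → ∃ χ, CraigInt L φ ψ χ

def IsBisim (σ : Finset ℕ) (F₁ : Frame) (V₁ : F₁.W → ℕ → Prop)
    (F₂ : Frame) (V₂ : F₂.W → ℕ → Prop) (Z : F₁.W → F₂.W → Prop) : Prop :=
  (∀ w₁ w₂, Z w₁ w₂ → ∀ p ∈ σ, (V₁ w₁ p ↔ V₂ w₂ p)) ∧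
  (∀ w₁ w₂ v₁, Z w₁ w₂ → F₁.R w₁ v₁ → ∃ v₂, F₂.R w₂ v₂ ∧ Z v₁ v₂) ∧
  (∀ w₁ w₂ v₂, Z w₁ w₂ → F₂.R w₂ v₂ → ∃ v₁, F₁.R w₁ v₁ ∧ Z v₁ v₂)

def Bisim (σ : Finset ℕ) (F₁ : Frame) (V₁ : F₁.W → ℕ → Prop) (w₁ : F₁.W)
    (F₂ : Frame) (V₂ : F₂.W → ℕ → Prop) (w₂ : F₂.W) : Prop :=
  ∃ Z, IsBisim σ F₁ V₁ F₂ V₂ Z ∧ Z w₁ w₂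

def IsEME (σ : Finset ℕ) (Φ : Finset (MForm ℕ)) : Prop :=
  (∀ φ ∈ Φ, φ.IsProp ∧ φ.sig ⊆ σ) ∧
  (∀ v : ℕ → Prop, ∃ φ ∈ Φ, psat v φ) ∧
  (∀ φ ∈ Φ, ∀ ψ ∈ Φ, φ ≠ ψ → ∀ v : ℕ → Prop, ¬ (psat v φ ∧ psat v ψ))

def IsCover (σ : Finset ℕ) (Φ : Finset (MForm ℕ)) (F : Frame) (V : F.W → ℕ → Prop) : Prop :=
  ∀ φ ∈ Φ, ∀ w₁ w₂, sat F V w₁ φ → sat F V w₂ φ →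
    ∀ χ : MForm ℕ, χ.IsProp → χ.sig ⊆ σ → (sat F V w₁ χ ↔ sat F V w₂ χ)

noncomputable def coverFml (σ : Finset ℕ) (Φ : Finset (MForm ℕ)) (N : ℕ) : MForm ℕ :=
  bigAnd (Φ.toList.map (fun φ => bigAnd (σ.toList.map (fun p =>
    MForm.imp (dle N (.and φ (.atom p))) (ble N (MForm.imp φ (.atom p)))))))

/-- A normal modal logic. -/
structure IsNormal (L : Set (MForm ℕ)) : Prop where
  taut : ∀ φ : MForm ℕ, φ.IsProp → PTaut φ → φ ∈ L
  kax : ∀ φ ψ : MForm ℕ, (MForm.box (φ.imp ψ)).imp ((MForm.box φ).imp (MForm.box ψ)) ∈ L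
  mp : ∀ φ ψ : MForm ℕ, φ.imp ψ ∈ L → φ ∈ L → ψ ∈ L
  subst : ∀ (s : ℕ → MForm ℕ) (φ : MForm ℕ), φ ∈ L → substAtoms s φ ∈ L
  nec : ∀ φ : MForm ℕ, φ ∈ L → MForm.box φ ∈ L

/-- A tabular normal modal logic: the logic of a finite set of finite pointed frames. -/
def Tabular (L : Set (MForm ℕ)) : Prop :=
  ∃ (ι : Type) (_ : Fintype ι) (Fr : ι → PFrame),
    (∀ i, Finite (Fr i).W) ∧ L = Log (Set.range Fr)

/-- A pre-tabular normal modal logic: not tabular, but every normal modal logic properly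
containing it is tabular. -/
def Pretabular (L : Set (MForm ℕ)) : Prop :=
  IsNormal L ∧ ¬ Tabular L ∧ ∀ L' : Set (MForm ℕ), IsNormal L' → L ⊂ L' → Tabular L'

/-- S4: the logic of all pointed frames with a reflexive and transitive relation. -/
def S4log : Set (MForm ℕ) :=
  {φ | ∀ F : Frame, Reflexive F.R → Transitive F.R → ∀ w : F.W, validAt F w φ}

/-- GL: the logic of all pointed frames whose relation is transitive and admits no
infinite ascending chain. -/
def GLlog : Set (MForm ℕ) :=
  {φ | ∀ F : Frame, Transitive F.R → (¬ ∃ c : ℕ → F.W, ∀ n, F.R (c n) (c (n + 1))) →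
    ∀ w : F.W, validAt F w φ}

/-- `withinSteps R k a b`: `b` is reachable from `a` by an `R`-path of length at most `k`. -/
def withinSteps {W : Type} (R : W → W → Prop) : ℕ → W → W → Prop
  | 0, a, b => a = b
  | k + 1, a, b => withinSteps R k a b ∨ ∃ c, withinSteps R k a c ∧ R c b

/-- A rooted pointed frame validates the logic `L`. -/
def Validates (F : Frame) (w : F.W) (L : Set (MForm ℕ)) : Prop :=
  ∀ χ ∈ L, validAt F w χ

/-- The poly-size model property. -/
def PSMP (L : Set (MForm ℕ)) : Prop :=
  ∃ r : Polynomial ℕ, ∀ φ : MForm ℕ, φ ∉ L →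
    ∃ (F : Frame) (w : F.W), Rooted F w ∧ Validates F w L ∧
      Finite F.W ∧ Nat.card F.W ≤ r.eval φ.dagSize ∧
      ∃ V : F.W → ℕ → Prop, ¬ sat F V w φ

/-- The exponential growth property. -/
def EGP (L : Set (MForm ℕ)) : Prop :=
  ∃ f : Polynomial ℕ, ∀ n : ℕ, 0 < n →
    ∃ (F : Frame) (w : F.W), Rooted F w ∧ Validates F w L ∧
      ∃ S : Set F.W, 2 ^ n ≤ S.ncard ∧ ∀ v ∈ S, withinSteps F.R (f.eval n) w v

set_option linter.unusedSimpArgs false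
set_option linter.unusedVariables false
/-! ### Truth relative to a set of worlds -/

def satOn {W : Type} (R : W → W → Prop) (Q : Set W) (V : W → ℕ → Prop) : W → MForm ℕ → Prop
  | _, .top => True
  | w, .atom p => V w p
  | w, .neg φ => ¬ satOn R Q V w φ
  | w, .and φ ψ => satOn R Q V w φ ∧ satOn R Q V w ψ
  | w, .box φ => ∀ v ∈ Q, R w v → satOn R Q V v φ

def VL {W : Type} (R : W → W → Prop) (Q : Set W) (L : Set (MForm ℕ)) : Prop :=
  ∀ χ ∈ L, ∀ V, ∀ w ∈ Q, satOn R Q V w χ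

theorem satOn_imp {W : Type} {R : W → W → Prop} {Q : Set W} {V : W → ℕ → Prop} {w : W}
    {φ ψ : MForm ℕ} :
    satOn R Q V w (φ.imp ψ) ↔ (satOn R Q V w φ → satOn R Q V w ψ) := by
  simp [MForm.imp, satOn]

theorem sat_imp {F : Frame} {V : F.W → ℕ → Prop} {w : F.W} {φ ψ : MForm ℕ} :
    sat F V w (φ.imp ψ) ↔ (sat F V w φ → sat F V w ψ) := by
  simp [MForm.imp, sat]

theorem sat_iff_satOn (F : Frame) (V : F.W → ℕ → Prop) (φ : MForm ℕ) :
    ∀ w, sat F V w φ ↔ satOn F.R Set.univ V w φ := by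
  induction φ with
  | top => intro w; simp [sat, satOn]
  | atom p => intro w; simp [sat, satOn]
  | neg φ ih => intro w; simp [sat, satOn, ih]
  | and φ ψ ih1 ih2 => intro w; simp [sat, satOn, ih1, ih2]
  | box φ ih => intro w; simp [sat, satOn, ih]

structure PM {W₁ W₂ : Type} (R₁ : W₁ → W₁ → Prop) (P : Set W₁) (R₂ : W₂ → W₂ → Prop)
    (Q : Set W₂) (f : W₁ → W₂) : Prop where
  maps : ∀ x ∈ P, f x ∈ Q
  forth : ∀ x ∈ P, ∀ y ∈ P, R₁ x y → R₂ (f x) (f y)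
  back : ∀ x ∈ P, ∀ v ∈ Q, R₂ (f x) v → ∃ y ∈ P, R₁ x y ∧ f y = v

theorem PM.sat {W₁ W₂ : Type} {R₁ : W₁ → W₁ → Prop} {P : Set W₁} {R₂ : W₂ → W₂ → Prop}
    {Q : Set W₂} {f : W₁ → W₂} (h : PM R₁ P R₂ Q f) {V₁ : W₁ → ℕ → Prop} {V₂ : W₂ → ℕ → Prop}
    (φ : MForm ℕ) (hV : ∀ p ∈ φ.sig, ∀ w ∈ P, (V₁ w p ↔ V₂ (f w) p)) :
    ∀ w ∈ P, (satOn R₁ P V₁ w φ ↔ satOn R₂ Q V₂ (f w) φ) := by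
  induction φ with
  | top => intro w _; simp [satOn]
  | atom p => intro w hw; simpa [satOn] using hV p (by simp [MForm.sig]) w hw
  | neg φ ih => intro w hw; simp only [satOn]; rw [ih hV w hw]
  | and φ ψ ih1 ih2 =>
    intro w hw
    simp only [satOn]
    rw [ih1 (fun p hp => hV p (by simp [MForm.sig, hp])) w hw,
      ih2 (fun p hp => hV p (by simp [MForm.sig, hp])) w hw]
  | box φ ih =>
    intro w hw
    simp only [satOn]
    constructor
    · intro H v hv hR
      obtain ⟨y, hy, hxy, rfl⟩ := h.back w hw v hv hR
      exact (ih hV y hy).1 (H y hy hxy)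
    · intro H y hy hR
      exact (ih hV y hy).2 (H _ (h.maps y hy) (h.forth w hw y hy hR))

theorem PM.vl {W₁ W₂ : Type} {R₁ : W₁ → W₁ → Prop} {P : Set W₁} {R₂ : W₂ → W₂ → Prop}
    {Q : Set W₂} {f : W₁ → W₂} (h : PM R₁ P R₂ Q f) (hs : ∀ v ∈ Q, ∃ x ∈ P, f x = v)
    {L : Set (MForm ℕ)} (hL : VL R₁ P L) : VL R₂ Q L := by
  intro χ hχ V w hw
  obtain ⟨x, hx, rfl⟩ := hs w hw
  exact (h.sat (V₁ := fun x p => V (f x) p) χ (fun _ _ _ _ => Iff.rfl) x hx).1 (hL χ hχ _ x hx)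

/-- Injective p-morphisms reflect validity. -/
theorem PM.vl_inj {W₁ W₂ : Type} {R₁ : W₁ → W₁ → Prop} {P : Set W₁} {R₂ : W₂ → W₂ → Prop}
    {Q : Set W₂} {f : W₁ → W₂} (h : PM R₁ P R₂ Q f) (hs : Function.Injective f)
    {L : Set (MForm ℕ)} (hL : VL R₂ Q L) : VL R₁ P L := by
  intro χ hχ V w hw
  refine (h.sat (V₁ := V) (V₂ := fun v p => ∃ y, f y = v ∧ V y p) χ ?_ w hw).2
    (hL χ hχ _ _ (h.maps w hw))
  intro p _ w _
  constructor
  · intro h1; exact ⟨w, rfl, h1⟩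
  · rintro ⟨y, hy, h1⟩; rwa [← hs hy]

theorem satOn_subst {W : Type} {R : W → W → Prop} {Q : Set W} {V : W → ℕ → Prop}
    (s : ℕ → MForm ℕ) (φ : MForm ℕ) :
    ∀ w, satOn R Q V w (substAtoms s φ) ↔ satOn R Q (fun w p => satOn R Q V w (s p)) w φ := by
  induction φ with
  | top => intro w; simp [substAtoms, satOn]
  | atom p => intro w; simp [substAtoms, satOn]
  | neg φ ih => intro w; simp [substAtoms, satOn, ih]
  | and φ ψ ih1 ih2 => intro w; simp [substAtoms, satOn, ih1, ih2]
  | box φ ih => intro w; simp [substAtoms, satOn, ih]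

theorem satOn_prop {W : Type} {R : W → W → Prop} {Q : Set W} {V : W → ℕ → Prop} {w : W}
    (φ : MForm ℕ) (h : φ.IsProp) : satOn R Q V w φ ↔ psat (V w) φ := by
  induction φ with
  | top => simp [psat, satOn]
  | atom p => simp [psat, satOn]
  | neg φ ih => simp only [psat, satOn]; rw [ih h]
  | and φ ψ ih1 ih2 => simp only [psat, satOn]; rw [ih1 h.1, ih2 h.2]
  | box φ ih => exact absurd h (by simp [MForm.IsProp])

/-- Generated subsets. -/
theorem VL.gen {W : Type} {R : W → W → Prop} {Q Q' : Set W} {L : Set (MForm ℕ)}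
    (h : VL R Q L) (hs : Q' ⊆ Q) (hup : ∀ x ∈ Q', ∀ y ∈ Q, R x y → y ∈ Q') : VL R Q' L := by
  refine PM.vl_inj (R₂ := R) (Q := Q) (f := id) ⟨fun x hx => hs hx, fun _ _ _ _ h => h, ?_⟩
    Function.injective_id h
  intro x hx v hv hR
  exact ⟨v, hup x hx v hv hR, hR, rfl⟩

/-! ### Logics of classes of relativised frames are normal -/

theorem isNormal_of_class {ι : Type 1} (W : ι → Type) (R : ∀ i, W i → W i → Prop)
    (Q : ∀ i, Set (W i)) :
    IsNormal {φ | ∀ i, ∀ V, ∀ w ∈ Q i, satOn (R i) (Q i) V w φ} where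
  taut := by
    intro φ hp ht i V w _
    exact (satOn_prop φ hp).2 (ht _)
  kax := by
    intro φ ψ i V w hw
    rw [satOn_imp, satOn_imp]
    intro h1 h2 v hv hR
    exact satOn_imp.1 (h1 v hv hR) (h2 v hv hR)
  mp := by
    intro φ ψ h1 h2 i V w hw
    exact satOn_imp.1 (h1 i V w hw) (h2 i V w hw)
  subst := by
    intro s φ h i V w hw
    exact (satOn_subst s φ w).2 (h i _ w hw)
  nec := by
    intro φ h i V w hw v hv _
    exact h i V v hv

/-! ### The canonical frame -/

structure IsTheory (L T : Set (MForm ℕ)) : Prop where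
  sub : L ⊆ T
  mp : ∀ φ ψ : MForm ℕ, φ.imp ψ ∈ T → φ ∈ T → ψ ∈ T

def sub3 (a b c : MForm ℕ) : ℕ → MForm ℕ
  | 0 => a
  | 1 => b
  | _ => c

theorem IsNormal.tautI {L : Set (MForm ℕ)} (hL : IsNormal L) (Φ : MForm ℕ) (h1 : Φ.IsProp)
    (h2 : PTaut Φ) (a b c : MForm ℕ) : substAtoms (sub3 a b c) Φ ∈ L :=
  hL.subst _ _ (hL.taut _ h1 h2)

abbrev atm0 : MForm ℕ := MForm.atom 0
abbrev atm1 : MForm ℕ := MForm.atom 1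
abbrev atm2 : MForm ℕ := MForm.atom 2

section Taut
variable {L : Set (MForm ℕ)} (a b c : MForm ℕ)

theorem IsNormal.t1 (hL : IsNormal L) : a.imp (b.imp a) ∈ L := by
  have := hL.tautI (atm0.imp (atm1.imp atm0)) (by simp [MForm.IsProp, MForm.imp])
    (by intro v; simp [psat, MForm.imp]; tauto) a b b
  simpa [substAtoms, sub3, MForm.imp] using this

theorem IsNormal.t2 (hL : IsNormal L) : (a.imp (b.imp c)).imp ((a.imp b).imp (a.imp c)) ∈ L := by
  have := hL.tautI ((atm0.imp (atm1.imp atm2)).imp ((atm0.imp atm1).imp (atm0.imp atm2)))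
    (by simp [MForm.IsProp, MForm.imp])
    (by intro v; simp [psat, MForm.imp]; tauto) a b c
  simpa [substAtoms, sub3, MForm.imp] using this

theorem IsNormal.t3 (hL : IsNormal L) : a.imp a ∈ L := by
  have := hL.tautI (atm0.imp atm0) (by simp [MForm.IsProp, MForm.imp])
    (by intro v; simp [psat, MForm.imp]) a a a
  simpa [substAtoms, sub3, MForm.imp] using this

theorem IsNormal.t4 (hL : IsNormal L) : (a.imp b).imp ((a.neg.imp b).imp b) ∈ L := by
  have := hL.tautI ((atm0.imp atm1).imp ((atm0.neg.imp atm1).imp atm1)) (by simp [MForm.IsProp, MForm.imp])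
    (by intro v; simp [psat, MForm.imp]; tauto) a b b
  simpa [substAtoms, sub3, MForm.imp] using this

theorem IsNormal.t5 (hL : IsNormal L) : a.imp (a.neg.imp b) ∈ L := by
  have := hL.tautI (atm0.imp (atm0.neg.imp atm1)) (by simp [MForm.IsProp, MForm.imp])
    (by intro v; simp [psat, MForm.imp]; tauto) a b b
  simpa [substAtoms, sub3, MForm.imp] using this

theorem IsNormal.t6 (hL : IsNormal L) : (a.and b).imp a ∈ L := by
  have := hL.tautI ((atm0.and atm1).imp atm0) (by simp [MForm.IsProp, MForm.imp])
    (by intro v; simp [psat, MForm.imp]; tauto) a b b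
  simpa [substAtoms, sub3, MForm.imp] using this

theorem IsNormal.t7 (hL : IsNormal L) : (a.and b).imp b ∈ L := by
  have := hL.tautI ((atm0.and atm1).imp atm1) (by simp [MForm.IsProp, MForm.imp])
    (by intro v; simp [psat, MForm.imp]) a b b
  simpa [substAtoms, sub3, MForm.imp] using this

theorem IsNormal.t8 (hL : IsNormal L) : a.imp (b.imp (a.and b)) ∈ L := by
  have := hL.tautI (atm0.imp (atm1.imp (atm0.and atm1))) (by simp [MForm.IsProp, MForm.imp])
    (by intro v; simp [psat, MForm.imp]; tauto) a b b
  simpa [substAtoms, sub3, MForm.imp] using this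

theorem IsNormal.t9 (hL : IsNormal L) : MForm.top ∈ L :=
  hL.taut _ (by simp [MForm.IsProp]) (by intro v; simp [psat])

end Taut

structure IsWorld (L T : Set (MForm ℕ)) : Prop extends IsTheory L T where
  neg : ∀ φ : MForm ℕ, MForm.neg φ ∈ T ↔ φ ∉ T

theorem IsWorld.and {L T : Set (MForm ℕ)} (hL : IsNormal L) (h : IsWorld L T) (φ ψ : MForm ℕ) :
    φ.and ψ ∈ T ↔ φ ∈ T ∧ ψ ∈ T := by
  constructor
  · intro H
    exact ⟨h.mp _ _ (h.sub (hL.t6 φ ψ)) H, h.mp _ _ (h.sub (hL.t7 φ ψ)) H⟩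
  · rintro ⟨h1, h2⟩
    exact h.mp _ _ (h.mp _ _ (h.sub (hL.t8 φ ψ)) h1) h2

theorem exists_world {L T : Set (MForm ℕ)} (hL : IsNormal L) (hT : IsTheory L T) {φ : MForm ℕ}
    (hφ : φ ∉ T) : ∃ w, IsWorld L w ∧ T ⊆ w ∧ φ ∉ w := by
  obtain ⟨M, hTM, hM⟩ := zorn_subset_nonempty {S | IsTheory L S ∧ φ ∉ S} (by
    intro c hc hch hne
    refine ⟨⋃₀ c, ⟨⟨?_, ?_⟩, ?_⟩, fun s hs => Set.subset_sUnion_of_mem hs⟩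
    · obtain ⟨s, hs⟩ := hne
      exact (hc hs).1.sub.trans (Set.subset_sUnion_of_mem hs)
    · rintro a b ⟨s, hs, h1⟩ ⟨t, ht, h2⟩
      rcases hch.total hs ht with h | h
      · exact ⟨t, ht, (hc ht).1.mp a b (h h1) h2⟩
      · exact ⟨s, hs, (hc hs).1.mp a b h1 (h h2)⟩
    · rintro ⟨s, hs, h1⟩
      exact (hc hs).2 h1) T ⟨hT, hφ⟩
  have hMt : IsTheory L M := hM.prop.1
  have hMφ : φ ∉ M := hM.prop.2
  have ext : ∀ ψ, ψ ∉ M → ψ.imp φ ∈ M := by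
    intro ψ hψ
    by_contra hcon
    have hth : IsTheory L {χ | ψ.imp χ ∈ M} := by
      refine ⟨fun χ hχ => ?_, fun a b h1 h2 => ?_⟩
      · exact hMt.mp _ _ (hMt.sub (hL.t1 χ ψ)) (hMt.sub hχ)
      · exact hMt.mp _ _ (hMt.mp _ _ (hMt.sub (hL.t2 ψ a b)) h1) h2
    have hsub : M ⊆ {χ | ψ.imp χ ∈ M} := by
      intro χ hχ
      exact hMt.mp _ _ (hMt.sub (hL.t1 χ ψ)) hχ
    have := hM.le_of_ge ⟨hth, hcon⟩ hsub
    exact hψ (this (hMt.sub (hL.t3 ψ)))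
  refine ⟨M, ⟨hMt, fun ψ => ?_⟩, hTM, hMφ⟩
  constructor
  · intro h1 h2
    exact hMφ (hMt.mp _ _ (hMt.mp _ _ (hMt.sub (hL.t5 ψ φ)) h2) h1)
  · intro h1
    by_contra h2
    exact hMφ (hMt.mp _ _ (hMt.mp _ _ (hMt.sub (hL.t4 ψ φ)) (ext _ h1)) (ext _ h2))

/-- Worlds of the canonical frame. -/
abbrev CW (L : Set (MForm ℕ)) : Type := {w : Set (MForm ℕ) // IsWorld L w}

def CR (L : Set (MForm ℕ)) (x y : CW L) : Prop := ∀ φ, MForm.box φ ∈ x.1 → φ ∈ y.1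

theorem exists_CW {L : Set (MForm ℕ)} (hL : IsNormal L) {φ : MForm ℕ} (h : φ ∉ L) :
    ∃ x : CW L, φ ∉ x.1 := by
  obtain ⟨w, hw, -, h2⟩ := exists_world hL (T := L) ⟨subset_rfl, hL.mp⟩ h
  exact ⟨⟨w, hw⟩, h2⟩

theorem CW.box {L : Set (MForm ℕ)} (hL : IsNormal L) (x : CW L) (φ : MForm ℕ) :
    MForm.box φ ∈ x.1 ↔ ∀ y, CR L x y → φ ∈ y.1 := by
  constructor
  · intro h y hy; exact hy φ h
  · intro h
    by_contra hc
    have hth : IsTheory L {χ | MForm.box χ ∈ x.1} := by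
      refine ⟨fun χ hχ => x.2.sub (hL.nec _ hχ), fun a b h1 h2 => ?_⟩
      exact x.2.mp _ _ (x.2.mp _ _ (x.2.sub (hL.kax a b)) h1) h2
    obtain ⟨w, hw, h1, h2⟩ := exists_world hL hth hc
    exact h2 (h ⟨w, hw⟩ h1)

theorem CW.imp {L : Set (MForm ℕ)} (hL : IsNormal L) (x : CW L) (φ ψ : MForm ℕ) :
    φ.imp ψ ∈ x.1 ↔ (φ ∈ x.1 → ψ ∈ x.1) := by
  unfold MForm.imp
  rw [x.2.neg, x.2.and hL, x.2.neg]; tauto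

theorem CW.subst {L : Set (MForm ℕ)} (hL : IsNormal L) (s : ℕ → MForm ℕ) (φ : MForm ℕ) :
    ∀ x : CW L, satOn (CR L) Set.univ (fun w p => s p ∈ w.1) x φ ↔ substAtoms s φ ∈ x.1 := by
  induction φ with
  | top => intro x; simp [satOn, substAtoms, x.2.sub hL.t9]
  | atom p => intro x; simp [satOn, substAtoms]
  | neg φ ih => intro x; simp only [satOn, substAtoms]; rw [ih, x.2.neg]
  | and φ ψ ih1 ih2 => intro x; simp only [satOn, substAtoms]; rw [ih1, ih2, x.2.and hL]
  | box φ ih => intro x; simp only [satOn, substAtoms]; rw [CW.box hL]; simp [ih]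

theorem substAtoms_atom (φ : MForm ℕ) : substAtoms MForm.atom φ = φ := by
  induction φ with
  | top => rfl
  | atom p => rfl
  | neg φ ih => simp [substAtoms, ih]
  | and φ ψ ih1 ih2 => simp [substAtoms, ih1, ih2]
  | box φ ih => simp [substAtoms, ih]

theorem CW.truth {L : Set (MForm ℕ)} (hL : IsNormal L) (φ : MForm ℕ) (x : CW L) :
    satOn (CR L) Set.univ (fun w p => MForm.atom p ∈ w.1) x φ ↔ φ ∈ x.1 := by
  have := CW.subst hL MForm.atom φ x
  rwa [substAtoms_atom] at this

/-! ### Definable sets of worlds -/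

def Dfn (L : Set (MForm ℕ)) (X : CW L → Prop) : Prop := ∃ ψ, ∀ x, X x ↔ ψ ∈ x.1

theorem Dfn.congr {L : Set (MForm ℕ)} {X Y : CW L → Prop} (h : Dfn L X)
    (h' : ∀ x, X x ↔ Y x) : Dfn L Y := by
  obtain ⟨ψ, h⟩ := h
  exact ⟨ψ, fun x => by rw [← h', h]⟩

section Dfn
variable {L : Set (MForm ℕ)}

theorem Dfn.not (hL : IsNormal L) {X : CW L → Prop} (h : Dfn L X) : Dfn L (fun x => ¬ X x) := by
  obtain ⟨ψ, h⟩ := h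
  exact ⟨ψ.neg, fun x => by simp only [x.2.neg, h]⟩

theorem Dfn.and (hL : IsNormal L) {X Y : CW L → Prop} (h : Dfn L X) (h' : Dfn L Y) :
    Dfn L (fun x => X x ∧ Y x) := by
  obtain ⟨ψ, h⟩ := h
  obtain ⟨χ, h'⟩ := h'
  exact ⟨ψ.and χ, fun x => by simp only [x.2.and hL, h, h']⟩

theorem Dfn.true (hL : IsNormal L) : Dfn L (fun _ => True) := ⟨.top, fun x => by simp [x.2.sub hL.t9]⟩

theorem Dfn.const (hL : IsNormal L) (p : Prop) : Dfn L (fun _ => p) := by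
  by_cases h : p
  · simpa [h] using Dfn.true hL
  · simpa [h] using Dfn.not hL (Dfn.true hL)

theorem Dfn.or (hL : IsNormal L) {X Y : CW L → Prop} (h : Dfn L X) (h' : Dfn L Y) :
    Dfn L (fun x => X x ∨ Y x) := by
  have := Dfn.not hL (Dfn.and hL (Dfn.not hL h) (Dfn.not hL h'))
  exact this.congr (fun x => by tauto)

theorem Dfn.imp (hL : IsNormal L) {X Y : CW L → Prop} (h : Dfn L X) (h' : Dfn L Y) :
    Dfn L (fun x => X x → Y x) := by
  have := Dfn.or hL (Dfn.not hL h) h'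
  exact this.congr (fun x => by tauto)

theorem Dfn.box (hL : IsNormal L) {X : CW L → Prop} (h : Dfn L X) : Dfn L (fun x => ∀ y, CR L x y → X y) := by
  obtain ⟨ψ, h⟩ := h
  exact ⟨ψ.box, fun x => by rw [CW.box hL]; simp [h]⟩

theorem Dfn.dia (hL : IsNormal L) {X : CW L → Prop} (h : Dfn L X) : Dfn L (fun x => ∃ y, CR L x y ∧ X y) := by
  have := Dfn.not hL (Dfn.box hL (Dfn.not hL h))
  exact this.congr (fun x => by push Not; rfl)

theorem Dfn.all (hL : IsNormal L) {ι : Type} [Finite ι] {X : ι → CW L → Prop} (h : ∀ i, Dfn L (X i)) :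
    Dfn L (fun x => ∀ i, X i x) := by
  have key : ∀ s : Set ι, s.Finite → Dfn L (fun x => ∀ i ∈ s, X i x) := by
    intro s hs
    induction s, hs using Set.Finite.induction_on with
    | empty => simpa using Dfn.true hL
    | insert _ _ ih => simpa using Dfn.and hL (h _) ih
  simpa using key Set.univ Set.finite_univ

theorem Dfn.ex (hL : IsNormal L) {ι : Type} [Finite ι] {X : ι → CW L → Prop} (h : ∀ i, Dfn L (X i)) :
    Dfn L (fun x => ∃ i, X i x) := by
  have := Dfn.not hL (Dfn.all hL (fun i => Dfn.not hL (h i)))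
  exact this.congr (fun x => by push Not; rfl)

/-- Definable p-morphic images of up-closed parts of the canonical frame validate `L`. -/
theorem vl_of_dfn (hL : IsNormal L) {W : Type} [Finite W] {R : W → W → Prop} {P : Set (CW L)} {Q : Set W}
    {f : CW L → W} (hP : ∀ x ∈ P, ∀ y, CR L x y → y ∈ P)
    (hf : PM (CR L) P R Q f) (hs : ∀ v ∈ Q, ∃ x ∈ P, f x = v)
    (hd : ∀ v, Dfn L (fun x => f x = v)) : VL R Q L := by
  intro χ hχ V w hw
  obtain ⟨x, hx, rfl⟩ := hs w hw
  have hdef : ∀ p, ∃ ψ, ∀ x : CW L, V (f x) p ↔ ψ ∈ x.1 := by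
    intro p
    have := Dfn.ex hL (X := fun v x => f x = v ∧ V v p)
      (fun v => Dfn.and hL (hd v) (Dfn.const hL _))
    obtain ⟨ψ, hψ⟩ := this
    exact ⟨ψ, fun x => by rw [← hψ]; simp⟩
  choose s hs' using hdef
  have h1 : satOn (CR L) Set.univ (fun w p => s p ∈ w.1) x χ :=
    (CW.subst hL s χ x).2 (x.2.sub (hL.subst s χ hχ))
  have hid : PM (CR L) P (CR L) Set.univ id :=
    ⟨fun _ _ => trivial, fun _ _ _ _ h => h, fun x hx v _ h => ⟨v, hP x hx v h, h, rfl⟩⟩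
  have h2 := (hid.sat χ (V₁ := fun w p => s p ∈ w.1) (fun _ _ _ _ => Iff.rfl) x hx).2 h1
  exact (hf.sat χ (V₁ := fun w p => s p ∈ w.1) (V₂ := V) (fun p _ w _ => (hs' p w).symm) x hx).1 h2

end Dfn
/-! ### From relativised frames to frames -/

theorem trans_of_VL {W : Type} {R : W → W → Prop} {Q : Set W} {L : Set (MForm ℕ)}
    (h4 : ∀ φ : MForm ℕ, (MForm.box φ).imp (MForm.box (MForm.box φ)) ∈ L) (hv : VL R Q L) :
    ∀ x ∈ Q, ∀ y ∈ Q, ∀ z ∈ Q, R x y → R y z → R x z := by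
  intro x hx y hy z hz hxy hyz
  have := hv _ (h4 (.atom 0)) (fun v _ => R x v) x hx
  rw [satOn_imp] at this
  exact this (fun v _ h => h) y hy hxy z hz hyz

theorem refl_of_VL {W : Type} {R : W → W → Prop} {Q : Set W} {L : Set (MForm ℕ)}
    (hT : ∀ φ : MForm ℕ, (MForm.box φ).imp φ ∈ L) (hv : VL R Q L) :
    ∀ x ∈ Q, R x x := by
  intro x hx
  have := hv _ (hT (.atom 0)) (fun v _ => R x v) x hx
  rw [satOn_imp] at this
  exact this (fun v _ h => h)

theorem irrefl_of_VL {W : Type} {R : W → W → Prop} {Q : Set W} {L : Set (MForm ℕ)}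
    (hlob : ∀ φ : MForm ℕ, (MForm.box ((MForm.box φ).imp φ)).imp (MForm.box φ) ∈ L)
    (hv : VL R Q L) : ∀ x ∈ Q, ¬ R x x := by
  intro x hx hR
  have := hv _ (hlob (.atom 0)) (fun v _ => v ≠ x) x hx
  rw [satOn_imp] at this
  refine this ?_ x hx hR rfl
  intro v hv hxv
  rw [satOn_imp]
  intro h1 h2
  subst h2
  exact h1 v hx hR rfl

theorem toFrame {W : Type} {R : W → W → Prop} {Q : Set W} {L : Set (MForm ℕ)} {r : W}
    (hr : r ∈ Q) (hv : VL R Q L)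
    (ht : ∀ x ∈ Q, ∀ y ∈ Q, ∀ z ∈ Q, R x y → R y z → R x z) :
    ∃ (F : Frame) (w : F.W) (e : F.W → W), Rooted F w ∧ Validates F w L ∧ Function.Injective e ∧
      PM F.R Set.univ R Q e ∧ e w = r ∧ (∀ v ∈ Q, R r v → ∃ u, e u = v ∧ F.R w u) := by
  let G : Set W := {v | v ∈ Q ∧ (v = r ∨ R r v)}
  let F : Frame := ⟨G, ⟨⟨r, hr, Or.inl rfl⟩⟩, fun a b => R a.1 b.1⟩
  have hpm : PM F.R Set.univ R Q (fun u : G => u.1) := by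
    refine ⟨fun x _ => x.2.1, fun x _ y _ h => h, ?_⟩
    intro x _ v hv h
    refine ⟨⟨v, hv, Or.inr ?_⟩, trivial, h, rfl⟩
    rcases x.2.2 with h1 | h1
    · rw [← h1]; exact h
    · exact ht r hr _ x.2.1 v hv h1 h
  refine ⟨F, ⟨r, hr, Or.inl rfl⟩, fun u => u.1, ?_, ?_, Subtype.val_injective, hpm, rfl, ?_⟩
  · rintro ⟨v, hv, h⟩
    rcases h with h | h
    · subst h; exact Relation.ReflTransGen.refl
    · exact Relation.ReflTransGen.single h
  · intro χ hχ V
    rw [sat_iff_satOn]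
    exact hpm.vl_inj Subtype.val_injective hv χ hχ V _ trivial
  · intro v hv h
    exact ⟨⟨v, hv, Or.inr h⟩, rfl, h⟩

/-! ### Formulas bounding the number of successors -/

theorem satOn_bigAnd {W : Type} {R : W → W → Prop} {Q : Set W} {V : W → ℕ → Prop} {w : W}
    (l : List (MForm ℕ)) : satOn R Q V w (bigAnd l) ↔ ∀ φ ∈ l, satOn R Q V w φ := by
  induction l with
  | nil => simp [bigAnd, satOn]
  | cons a l ih => simp [bigAnd, satOn, ih]

def altF (N : ℕ) : MForm ℕ :=
  .neg (bigAnd ((List.range (N + 1)).map (fun i => MForm.dia (.and (.atom i)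
    (bigAnd ((List.range i).map (fun j => .neg (.atom j))))))))

theorem satOn_altF {W : Type} {R : W → W → Prop} {Q : Set W} {V : W → ℕ → Prop} {w : W} (N : ℕ) :
    satOn R Q V w (altF N) ↔ ¬ ∀ i < N + 1, ∃ v ∈ Q, R w v ∧ V v i ∧ ∀ j < i, ¬ V v j := by
  simp only [altF, satOn, satOn_bigAnd, MForm.dia, List.mem_map, List.mem_range]
  apply not_congr
  constructor
  · intro h i hi
    have := h _ ⟨i, hi, rfl⟩
    simp only [satOn, satOn_bigAnd, List.mem_map, List.mem_range] at this
    push Not at this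
    obtain ⟨v, hv, h1, h2, h3⟩ := this
    refine ⟨v, hv, h1, h2, fun j hj => ?_⟩
    have := h3 _ ⟨j, hj, rfl⟩
    simpa [satOn] using this
  · rintro h _ ⟨i, hi, rfl⟩
    obtain ⟨v, hv, h1, h2, h3⟩ := h i hi
    intro h4
    apply h4 v hv h1
    refine ⟨h2, ?_⟩
    rw [satOn_bigAnd]
    intro φ hφ
    simp only [List.mem_map, List.mem_range] at hφ
    obtain ⟨j, hj, rfl⟩ := hφ
    simpa [satOn] using h3 j hj

theorem altF_of_card {W : Type} [Finite W] {R : W → W → Prop} {Q : Set W} {V : W → ℕ → Prop}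
    {w : W} {N : ℕ} (hN : Nat.card W ≤ N) : satOn R Q V w (altF N) := by
  rw [satOn_altF]
  intro h
  have h' : ∀ i : Fin (N + 1), ∃ v, V v i ∧ ∀ j < (i : ℕ), ¬ V v j := fun i => by
    obtain ⟨v, _, _, h1⟩ := h i i.2; exact ⟨v, h1⟩
  choose y hy using h'
  have hinj : Function.Injective y := by
    intro i j hij
    rcases lt_trichotomy i j with h1 | h1 | h1
    · exact absurd (hij ▸ (hy i).1) ((hy j).2 i h1)
    · exact h1
    · exact absurd (hij ▸ (hy j).1) ((hy i).2 j h1)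
  have := Nat.card_le_card_of_injective y hinj
  simp at this
  omega

theorem Tabular.altF {L : Set (MForm ℕ)} (h : Tabular L) : ∃ N, altF N ∈ L := by
  obtain ⟨ι, _, Fr, hfin, rfl⟩ := h
  refine ⟨Finset.univ.sup (fun i => Nat.card (Fr i).W), ?_⟩
  rintro P ⟨i, rfl⟩ V
  rw [sat_iff_satOn]
  haveI := hfin i
  exact altF_of_card (Finset.le_sup (f := fun i => Nat.card (Fr i).W) (Finset.mem_univ i))

/-! ### Key frames -/

structure KF (L : Set (MForm ℕ)) (M : ℕ) {W : Type} (R : W → W → Prop) (Q A : Set W) : Prop where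
  fin : Q.Finite
  sub : A ⊆ Q
  ne : A.Nonempty
  small : (Q \ A).ncard ≤ M
  sel : ∀ X ⊆ A, X.Nonempty → ∃ a ∈ X, ∀ y ∈ Q, ∀ b ∈ X, R y b → b = y ∨ R y a
  vl : ∀ A' ⊆ A, A'.Nonempty → VL R ((Q \ A) ∪ A') L

theorem KF.vl' {L : Set (MForm ℕ)} {M : ℕ} {W : Type} {R : W → W → Prop} {Q A : Set W}
    (h : KF L M R Q A) : VL R Q L := by
  have := h.vl A subset_rfl h.ne
  rwa [Set.diff_union_of_subset h.sub] at this

theorem self_mem_subf (φ : MForm ℕ) : φ ∈ φ.subf := by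
  cases φ <;> simp [MForm.subf]

theorem KF.small_model {L : Set (MForm ℕ)} {M : ℕ} {W : Type} {R : W → W → Prop} {Q A : Set W}
    (h : KF L M R Q A) (V : W → ℕ → Prop) {w : W} (hw : w ∈ Q) {φ : MForm ℕ}
    (hφ : ¬ satOn R Q V w φ) :
    ∃ Q' : Set W, w ∈ Q' ∧ VL R Q' L ∧ Q'.Finite ∧ Q'.ncard ≤ M + (φ.dagSize + 1) ∧
      ¬ satOn R Q' V w φ := by
  classical
  obtain ⟨a0, ha0⟩ := h.ne
  let X : MForm ℕ → Set W := fun ψ => {a | a ∈ A ∧ ¬ satOn R Q V a ψ}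
  have hsel : ∀ ψ, ∃ a, a ∈ A ∧ ((X ψ).Nonempty → a ∈ X ψ ∧
      ∀ y ∈ Q, ∀ b ∈ X ψ, R y b → b = y ∨ R y a) := by
    intro ψ
    by_cases hX : (X ψ).Nonempty
    · obtain ⟨a, ha, h2⟩ := h.sel (X ψ) (fun a ha => ha.1) hX
      exact ⟨a, ha.1, fun _ => ⟨ha, h2⟩⟩
    · exact ⟨a0, ha0, fun h => absurd h hX⟩
  choose s hsA hs using hsel
  let w' : W := if w ∈ A then w else a0
  have hw' : w' ∈ A := by simp only [w']; split_ifs with h1 <;> assumption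
  let B : Finset W := insert w' (φ.subf.image s)
  have hBA : (B : Set W) ⊆ A := by
    intro x hx
    simp only [B, Finset.coe_insert, Finset.coe_image, Set.mem_insert_iff, Set.mem_image] at hx
    rcases hx with rfl | ⟨ψ, _, rfl⟩
    · exact hw'
    · exact hsA ψ
  set Q' : Set W := (Q \ A) ∪ B with hQ'
  have hQQ : Q' ⊆ Q := by
    intro x hx
    rcases hx with hx | hx
    · exact hx.1
    · exact h.sub (hBA hx)
  have hwQ : w ∈ Q' := by
    by_cases hwA : w ∈ A
    · right; simp [B, w', hwA]
    · left; exact ⟨hw, hwA⟩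
  have truth : ∀ ψ, ψ.subf ⊆ φ.subf → ∀ y ∈ Q', (satOn R Q' V y ψ ↔ satOn R Q V y ψ) := by
    intro ψ
    induction ψ with
    | top => intro _ y _; simp [satOn]
    | atom p => intro _ y _; simp [satOn]
    | neg ψ ih =>
      intro hsub y hy
      simp only [satOn]
      rw [ih (fun x hx => hsub (by simp [MForm.subf, hx])) y hy]
    | and ψ χ ih1 ih2 =>
      intro hsub y hy
      simp only [satOn]
      rw [ih1 (fun x hx => hsub (by simp [MForm.subf, hx])) y hy,
        ih2 (fun x hx => hsub (by simp [MForm.subf, hx])) y hy]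
    | box ψ ih =>
      intro hsub y hy
      have hsub' : ψ.subf ⊆ φ.subf := fun x hx => hsub (by simp [MForm.subf, hx])
      simp only [satOn]
      constructor
      · intro H v hv hR
        by_contra hc
        by_cases hvA : v ∈ A
        · have hvX : v ∈ X ψ := ⟨hvA, hc⟩
          obtain ⟨h1, h2⟩ := hs ψ ⟨v, hvX⟩
          have hsQ : s ψ ∈ Q' := by
            right
            simp only [B, Finset.coe_insert, Finset.coe_image, Set.mem_insert_iff, Set.mem_image]
            exact Or.inr ⟨ψ, hsub' (self_mem_subf ψ), rfl⟩
          rcases h2 y (hQQ hy) v hvX hR with h3 | h3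
          · subst h3
            exact hc ((ih hsub' v hy).1 (H v hy hR))
          · exact h1.2 ((ih hsub' _ hsQ).1 (H _ hsQ h3))
        · have hvQ : v ∈ Q' := Or.inl ⟨hv, hvA⟩
          exact hc ((ih hsub' v hvQ).1 (H v hvQ hR))
      · intro H v hv hR
        exact (ih hsub' v hv).2 (H v (hQQ hv) hR)
  refine ⟨Q', hwQ, h.vl B hBA ⟨w', by simp [B]⟩, h.fin.subset hQQ, ?_, ?_⟩
  · refine (Set.ncard_union_le _ _).trans (add_le_add h.small ?_)
    rw [Set.ncard_coe_finset]
    refine (Finset.card_insert_le _ _).trans ?_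
    have := Finset.card_image_le (s := φ.subf) (f := s)
    simp only [MForm.dagSize]
    omega
  · rw [truth φ subset_rfl w hwQ]; exact hφ

/-- There are arbitrarily wide key frames. -/
def Wide (L : Set (MForm ℕ)) : Prop :=
  ∃ M : ℕ, ∀ N : ℕ, ∃ (W : Type) (R : W → W → Prop) (Q A : Set W) (r : W), KF L M R Q A ∧ r ∈ Q ∧
    ∃ y : Fin (N + 1) → W, Function.Injective y ∧ ∀ i, y i ∈ Q ∧ R r (y i)

theorem master {L : Set (MForm ℕ)} (hpre : Pretabular L)
    (h4 : ∀ φ : MForm ℕ, (MForm.box φ).imp (MForm.box (MForm.box φ)) ∈ L) (hw : Wide L) :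
    PSMP L ∧ EGP L := by
  obtain ⟨M, hM⟩ := hw
  constructor
  · let ι : Type 1 := {i : Σ W : Type, (W → W → Prop) × Set W // ∃ A, KF L M i.2.1 i.2.2 A}
    have hnorm := isNormal_of_class (ι := ι) (fun i => i.1.1) (fun i => i.1.2.1) (fun i => i.1.2.2)
    set L' := {φ | ∀ i : ι, ∀ V, ∀ w ∈ i.1.2.2, satOn i.1.2.1 i.1.2.2 V w φ} with hL'
    have hsub : L ⊆ L' := by
      intro χ hχ i V w hw
      obtain ⟨A, hA⟩ := i.2
      exact hA.vl' χ hχ V w hw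
    have hnt : ¬ Tabular L' := by
      intro ht
      obtain ⟨N, hN⟩ := ht.altF
      obtain ⟨W, R, Q, A, r, hK, hr, y, hy, hyQ⟩ := hM N
      have := hN ⟨⟨W, R, Q⟩, A, hK⟩ (fun v p => ∃ i : Fin (N + 1), (i : ℕ) = p ∧ v = y i) r hr
      rw [satOn_altF] at this
      apply this
      intro i hi
      refine ⟨y ⟨i, hi⟩, (hyQ _).1, (hyQ _).2, ⟨⟨i, hi⟩, rfl, rfl⟩, ?_⟩
      rintro j hj ⟨k, hk, h⟩
      have := hy h
      subst this
      simp at hk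
      omega
    have heq : L = L' := by
      by_contra hne
      exact hnt (hpre.2.2 L' hnorm (hsub.ssubset_of_ne hne))
    refine ⟨Polynomial.X + Polynomial.C (M + 1), fun φ hφ => ?_⟩
    rw [heq] at hφ
    simp only [hL', Set.mem_setOf_eq] at hφ
    push Not at hφ
    obtain ⟨i, V, w, hw, hnot⟩ := hφ
    obtain ⟨A, hA⟩ := i.2
    obtain ⟨Q', hwQ, hv, hfin, hcard, hns⟩ := hA.small_model V hw hnot
    obtain ⟨F, u, e, hroot, hval, hinj, hpm, heu, -⟩ := toFrame hwQ hv (trans_of_VL h4 hv)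
    haveI := hfin.to_subtype
    let e' : F.W → Q' := fun x => ⟨e x, hpm.maps x trivial⟩
    have he' : Function.Injective e' := fun a b hab => hinj (congrArg Subtype.val hab)
    refine ⟨F, u, hroot, hval, Finite.of_injective e' he', ?_, fun x p => V (e x) p, ?_⟩
    · have h1 := Nat.card_le_card_of_injective e' he'
      rw [Nat.card_coe_set_eq] at h1
      simp only [Polynomial.eval_add, Polynomial.eval_X, Polynomial.eval_C]
      omega
    · rw [sat_iff_satOn]
      rw [hpm.sat (V₂ := V) φ (fun _ _ _ _ => Iff.rfl) u trivial, heu]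
      exact hns
  · refine ⟨1, fun n _ => ?_⟩
    obtain ⟨W, R, Q, A, r, hK, hr, y, hy, hyQ⟩ := hM (2 ^ n)
    obtain ⟨F, u, e, hroot, hval, hinj, hpm, heu, hsucc⟩ := toFrame hr hK.vl' (trans_of_VL h4 hK.vl')
    have : ∀ i, ∃ u', e u' = y i ∧ F.R u u' := fun i => hsucc _ (hyQ i).1 (hyQ i).2
    choose z hz using this
    have hzi : Function.Injective z := by
      intro i j hij
      apply hy
      rw [← (hz i).1, ← (hz j).1, hij]
    refine ⟨F, u, hroot, hval, Set.range z, ?_, ?_⟩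
    · rw [← Nat.card_coe_set_eq, Nat.card_range_of_injective hzi]
      simp
    · rintro _ ⟨i, rfl⟩
      simp only [Polynomial.eval_one, withinSteps]
      exact Or.inr ⟨u, rfl, (hz i).2⟩
/-! ### Axioms -/

theorem ax_T {L : Set (MForm ℕ)} (h : S4log ⊆ L) (φ : MForm ℕ) : (MForm.box φ).imp φ ∈ L := by
  apply h
  intro F hr ht w V
  rw [sat_imp]
  intro h1
  exact h1 w (hr w)

theorem ax_4 {L : Set (MForm ℕ)} (h : S4log ⊆ L ∨ GLlog ⊆ L) (φ : MForm ℕ) :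
    (MForm.box φ).imp (MForm.box (MForm.box φ)) ∈ L := by
  rcases h with h | h
  · apply h
    intro F hr ht w V
    rw [sat_imp]
    intro h1 v hv u hu
    exact h1 u (ht hv hu)
  · apply h
    intro F ht _ w V
    rw [sat_imp]
    intro h1 v hv u hu
    exact h1 u (ht hv hu)

theorem ax_lob {L : Set (MForm ℕ)} (h : GLlog ⊆ L) (φ : MForm ℕ) :
    (MForm.box ((MForm.box φ).imp φ)).imp (MForm.box φ) ∈ L := by
  apply h
  intro F ht hc w V
  rw [sat_imp]
  intro h1 v hv
  by_contra hn
  apply hc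
  have key : ∀ u : {u : F.W // F.R w u ∧ ¬ sat F V u φ}, ∃ u' : {u : F.W // F.R w u ∧ ¬ sat F V u φ},
      F.R u.1 u'.1 := by
    rintro ⟨u, hu, hnu⟩
    have := h1 u hu
    rw [sat_imp] at this
    by_contra hcon
    apply hnu
    apply this
    intro u' hu'
    by_contra hnu'
    exact hcon ⟨⟨u', ht hu hu', hnu'⟩, hu'⟩
  choose g hg using key
  let c : ℕ → {u : F.W // F.R w u ∧ ¬ sat F V u φ} := fun n => Nat.rec ⟨v, hv, hn⟩ (fun _ u => g u) n
  exact ⟨fun n => (c n).1, fun n => hg (c n)⟩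

theorem CR_trans {L : Set (MForm ℕ)} (hL : IsNormal L)
    (h4 : ∀ φ : MForm ℕ, (MForm.box φ).imp (MForm.box (MForm.box φ)) ∈ L) {x y z : CW L}
    (h1 : CR L x y) (h2 : CR L y z) : CR L x z := by
  intro φ hφ
  have := x.2.sub (h4 φ)
  rw [CW.imp hL] at this
  exact h2 φ (h1 _ (this hφ))

theorem CR_refl {L : Set (MForm ℕ)} (hL : IsNormal L)
    (hT : ∀ φ : MForm ℕ, (MForm.box φ).imp φ ∈ L) (x : CW L) : CR L x x := by
  intro φ hφ
  have := x.2.sub (hT φ)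
  rw [CW.imp hL] at this
  exact this hφ

/-- Löb property of definable sets. -/
theorem Dfn.lob {L : Set (MForm ℕ)} (hL : IsNormal L)
    (hlob : ∀ φ : MForm ℕ, (MForm.box ((MForm.box φ).imp φ)).imp (MForm.box φ) ∈ L)
    {X : CW L → Prop} (h : Dfn L X) {x y : CW L} (hxy : CR L x y) (hy : X y) :
    ∃ z, CR L x z ∧ X z ∧ ∀ u, CR L z u → ¬ X u := by
  obtain ⟨ψ, hψ⟩ := Dfn.not hL h
  by_contra hcon
  push Not at hcon
  have := x.2.sub (hlob ψ)
  rw [CW.imp hL, CW.box hL, CW.box hL] at this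
  refine ((hψ y).2 (this ?_ y hxy)) hy
  intro z hz
  rw [CW.imp hL, CW.box hL]
  intro h1
  rw [← hψ]
  intro hz'
  obtain ⟨u, hu, hu'⟩ := hcon z hz hz'
  exact (hψ u).2 (h1 u hu) hu'

/-! ### Chains -/

theorem wide_of_chains {L : Set (MForm ℕ)} (S : ℕ → ℕ → Prop)
    (hS1 : ∀ a b, b < a → S a b) (hS2 : ∀ a b, S a b → b ≤ a)
    (hSS : ∀ a b a' b', (b < a ↔ b' < a') → (a = b ↔ a' = b') → (S a b ↔ S a' b'))
    (h : ∀ n : ℕ, VL (fun a b : Fin (n + 1) => S a b) Set.univ L) : Wide L := by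
  refine ⟨0, fun N => ?_⟩
  refine ⟨Fin (N + 2), fun a b => S a b, Set.univ, Set.univ, Fin.last _, ?_, trivial, ?_⟩
  · refine ⟨Set.toFinite _, subset_rfl, Set.univ_nonempty, by simp, ?_, ?_⟩
    · intro X _ hX
      obtain ⟨a, ha, hmin⟩ := (Set.toFinite X).exists_minimal hX
      refine ⟨a, ha, fun y _ b hb hyb => ?_⟩
      by_cases hby : b = y
      · exact Or.inl hby
      · right
        apply hS1
        have h1 := hS2 _ _ hyb
        have h2 : a ≤ b := by
          rcases le_total a b with h | h
          · exact h
          · exact hmin hb h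
        have h3 : (b : ℕ) ≠ y := fun h => hby (Fin.ext h)
        have h2' : (a : ℕ) ≤ b := h2
        omega
    · intro A' _ hA'
      rw [Set.sdiff_self, Set.empty_union]
      classical
      let s : Finset (Fin (N + 2)) := A'.toFinite.toFinset
      have hs : 0 < s.card := by
        rw [Finset.card_pos]
        obtain ⟨a, ha⟩ := hA'
        exact ⟨a, by simpa [s] using ha⟩
      obtain ⟨k, hk⟩ : ∃ k, s.card = k + 1 := ⟨s.card - 1, by omega⟩
      let e := s.orderIsoOfFin hk
      have hmem : ∀ a, a ∈ s ↔ a ∈ A' := fun a => by simp [s]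
      have hpm : PM (fun a b : Fin (k + 1) => S a b) Set.univ (fun a b : Fin (N + 2) => S a b) A'
          (fun i => (e i : Fin (N + 2))) := by
        have hiff : ∀ i j : Fin (k + 1), S (e i : Fin (N + 2)) (e j : Fin (N + 2)) ↔ S i j := by
          intro i j
          apply hSS
          · have : e j < e i ↔ j < i := e.lt_iff_lt
            exact this
          · have : e i = e j ↔ i = j := e.injective.eq_iff
            rw [← Fin.ext_iff, ← Fin.ext_iff, ← this, Subtype.ext_iff]
        refine ⟨fun x _ => (hmem _).1 (e x).2, fun x _ y _ h => (hiff x y).2 h, ?_⟩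
        intro x _ v hv hxv
        refine ⟨e.symm ⟨v, (hmem v).2 hv⟩, trivial, ?_, by simp⟩
        rw [← hiff]
        simpa using hxv
      refine hpm.vl ?_ (h k)
      intro v hv
      exact ⟨e.symm ⟨v, (hmem v).2 hv⟩, trivial, by simp⟩
  · refine ⟨fun i => i.castSucc, Fin.castSucc_injective _, fun i => ⟨trivial, hS1 _ _ ?_⟩⟩
    simp
    omega

/-- GL chains. -/
def bx {L : Set (MForm ℕ)} : ℕ → CW L → Prop
  | 0, _ => False
  | k + 1, x => ∀ y, CR L x y → bx k y

theorem bx_dfn {L : Set (MForm ℕ)} (hL : IsNormal L) (k : ℕ) : Dfn L (bx (L := L) k) := by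
  induction k with
  | zero => exact Dfn.const hL False
  | succ k ih => exact Dfn.box hL ih

theorem bx_mono {L : Set (MForm ℕ)} {j k : ℕ} (hjk : j ≤ k) (x : CW L) (h : bx j x) : bx k x := by
  induction j generalizing k x with
  | zero => exact h.elim
  | succ j ih =>
    obtain ⟨k, rfl⟩ : ∃ k', k = k' + 1 := ⟨k - 1, by omega⟩
    intro y hy
    exact ih (by omega) y (h y hy)

theorem wide_GL_chain {L : Set (MForm ℕ)} (hL : IsNormal L)
    (hlob : ∀ φ : MForm ℕ, (MForm.box ((MForm.box φ).imp φ)).imp (MForm.box φ) ∈ L)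
    (hd : ∀ d, ∃ x : CW L, ¬ bx d x) : Wide L := by
  classical
  apply wide_of_chains (fun a b => b < a) (fun a b h => h) (fun a b h => h.le)
    (fun a b a' b' h _ => h)
  intro n
  let P : Set (CW L) := {x | bx (n + 1) x}
  let f0 : CW L → ℕ := fun x => Nat.findGreatest (fun k => ¬ bx k x) n
  have hf0 : ∀ x, f0 x < n + 1 := fun x => Nat.lt_succ_of_le (Nat.findGreatest_le _)
  have hspec : ∀ x ∈ P, bx (f0 x + 1) x ∧ ¬ bx (f0 x) x := by
    intro x hx
    constructor
    · rcases Nat.lt_or_ge (f0 x) n with h | h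
      · by_contra hcon
        exact Nat.findGreatest_is_greatest (P := fun k => ¬ bx k x) (n := n)
          (k := f0 x + 1) (Nat.lt_succ_self _) h hcon
      · exact bx_mono (by omega) x hx
    · exact Nat.findGreatest_spec (P := fun k => ¬ bx k x) (m := 0) (Nat.zero_le n) (fun h => h)
  have hchar : ∀ x ∈ P, ∀ k, bx (k + 1) x → ¬ bx k x → f0 x = k := by
    intro x hx k h1 h2
    obtain ⟨h3, h4⟩ := hspec x hx
    rcases lt_trichotomy (f0 x) k with h | h | h
    · exact absurd (bx_mono (by omega) x h3) h2
    · exact h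
    · exact absurd (bx_mono (by omega) x h1) h4
  have hP : ∀ x ∈ P, ∀ y, CR L x y → y ∈ P := by
    intro x hx y hxy
    exact bx_mono (Nat.le_succ n) y (hx y hxy)
  have hback : ∀ x ∈ P, ∀ k < f0 x, ∃ y, CR L x y ∧ bx (k + 1) y ∧ ¬ bx k y := by
    intro x hx k hk
    have h1 : ¬ bx (k + 1) x := fun h => (hspec x hx).2 (bx_mono (by omega) x h)
    have : ∃ y, CR L x y ∧ ¬ bx k y := by
      by_contra hcon
      push Not at hcon
      exact h1 hcon
    obtain ⟨y, hy, hy'⟩ := this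
    obtain ⟨z, hz, hz1, hz2⟩ := Dfn.lob hL hlob (Dfn.not hL (bx_dfn hL k)) hy hy'
    exact ⟨z, hz, fun u hu => not_not.1 (hz2 u hu), hz1⟩
  have htop : ∃ x ∈ P, f0 x = n := by
    obtain ⟨x, hx⟩ := hd (n + 1)
    have : ∃ y, CR L x y ∧ ¬ bx n y := by
      by_contra hcon
      push Not at hcon
      exact hx hcon
    obtain ⟨y, hy, hy'⟩ := this
    obtain ⟨z, hz, hz1, hz2⟩ := Dfn.lob hL hlob (Dfn.not hL (bx_dfn hL n)) hy hy'
    have hzP : z ∈ P := fun u hu => not_not.1 (hz2 u hu)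
    exact ⟨z, hzP, hchar z hzP n hzP hz1⟩
  have hpm : PM (CR L) P (fun a b : Fin (n + 1) => (b : ℕ) < a) Set.univ
      (fun x => ⟨f0 x, hf0 x⟩) := by
    refine ⟨fun _ _ => trivial, ?_, ?_⟩
    · intro x hx y hy hxy
      by_contra hcon
      have hcon' : f0 x ≤ f0 y := not_lt.1 hcon
      have := (hspec x hx).1 y hxy
      exact (hspec y hy).2 (bx_mono hcon' y this)
    · intro x hx v _ hv
      obtain ⟨y, hy, h1, h2⟩ := hback x hx v hv
      refine ⟨y, hP x hx y hy, hy, Fin.ext (hchar y (hP x hx y hy) v h1 h2)⟩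
  refine vl_of_dfn hL hP hpm ?_ ?_
  · intro v _
    obtain ⟨x, hx, hxn⟩ := htop
    rcases Nat.lt_or_ge v n with h | h
    · obtain ⟨y, hy, h1, h2⟩ := hback x hx v (by omega)
      exact ⟨y, hP x hx y hy, Fin.ext (hchar y (hP x hx y hy) v h1 h2)⟩
    · exact ⟨x, hx, Fin.ext (by have := v.2; show f0 x = v; omega)⟩
  · intro v
    have : Dfn L (fun x => ((v = (0 : ℕ)) ∨ ¬ bx v x) ∧
        ∀ k : Fin (n + 1), ((v : ℕ) < k → bx k x)) := by
      apply Dfn.and hL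
      · exact Dfn.or hL (Dfn.const hL _) (Dfn.not hL (bx_dfn hL _))
      · exact Dfn.all hL (fun k => Dfn.imp hL (Dfn.const hL _) (bx_dfn hL _))
    refine this.congr ?_
    intro x
    rw [Fin.ext_iff]
    show _ ↔ f0 x = v
    rw [Nat.findGreatest_eq_iff]
    have hv := v.2
    constructor
    · rintro ⟨h1, h2⟩
      refine ⟨by omega, fun h => h1.resolve_left (fun h' => h h'), ?_⟩
      intro k hk hkn
      exact not_not.2 (h2 ⟨k, by omega⟩ hk)
    · rintro ⟨h1, h2, h3⟩
      refine ⟨?_, ?_⟩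
      · by_cases h : (v : ℕ) = 0
        · exact Or.inl h
        · exact Or.inr (h2 h)
      · intro k hk
        exact not_not.1 (h3 hk (by omega))
/-! ### Depth -/

def Dle {W : Type} (R : W → W → Prop) : ℕ → W → Prop
  | 0, _ => False
  | k + 1, x => ∀ y, R x y → ¬ R y x → Dle R k y

theorem Dle.mono {W : Type} {R : W → W → Prop} {j k : ℕ} (hjk : j ≤ k) (x : W) (h : Dle R j x) :
    Dle R k x := by
  induction j generalizing k x with
  | zero => exact h.elim
  | succ j ih =>
    obtain ⟨k, rfl⟩ : ∃ k', k = k' + 1 := ⟨k - 1, by omega⟩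
    intro y hy hy'
    exact ih (by omega) y (h y hy hy')

theorem Dle.up {W : Type} {R : W → W → Prop} (ht : ∀ x y z, R x y → R y z → R x z) {k : ℕ} {x y : W}
    (h : Dle R k x) (hxy : R x y) : Dle R k y := by
  cases k with
  | zero => exact h.elim
  | succ k =>
    intro z hz hz'
    exact h z (ht _ _ _ hxy hz) (fun h => hz' (ht _ _ _ h hxy))

theorem chain_of_not_Dle {W : Type} {R : W → W → Prop} (n : ℕ) (x : W) (h : ¬ Dle R (n + 1) x) :
    ∃ c : ℕ → W, c n = x ∧ ∀ i < n, R (c (i + 1)) (c i) ∧ ¬ R (c i) (c (i + 1)) := by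
  induction n generalizing x with
  | zero => exact ⟨fun _ => x, rfl, fun i hi => by omega⟩
  | succ n ih =>
    have : ∃ y, R x y ∧ ¬ R y x ∧ ¬ Dle R (n + 1) y := by
      by_contra hcon
      push Not at hcon
      exact h hcon
    obtain ⟨y, h1, h2, h3⟩ := this
    obtain ⟨c, hc, hc'⟩ := ih y h3
    refine ⟨fun i => if i ≤ n then c i else x, by simp, ?_⟩
    intro i hi
    rcases Nat.lt_or_ge i n with h | h
    · have e1 : i ≤ n := by omega
      have e2 : i + 1 ≤ n := by omega
      simp only [e1, e2, if_true]
      exact hc' i h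
    · obtain rfl : i = n := by omega
      simp [hc, h1, h2]

def Gs {W : Type} (U : ℕ → W → Prop) : ℕ → W → Prop
  | 0, x => U 0 x
  | i + 1, x => Gs U i x ∨ U (i + 1) x

def Qs {W : Type} (R : W → W → Prop) (U : ℕ → W → Prop) : ℕ → W → Prop
  | 0, x => Gs U 0 x
  | i + 1, x => (Gs U (i + 1) x ∧ ¬ Gs U i x) ∧ ∃ y, R x y ∧ Qs R U i y

theorem wide_S4_chain {L : Set (MForm ℕ)} (hL : IsNormal L)
    (h4 : ∀ φ : MForm ℕ, (MForm.box φ).imp (MForm.box (MForm.box φ)) ∈ L)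
    (hT : ∀ φ : MForm ℕ, (MForm.box φ).imp φ ∈ L)
    (hd : ∀ d, ∃ x : CW L, ¬ Dle (CR L) d x) : Wide L := by
  classical
  apply wide_of_chains (fun a b => b ≤ a) (fun a b h => le_of_lt h) (fun a b h => h)
    (fun a b a' b' h h' => by omega)
  intro n
  have ht : ∀ x y z : CW L, CR L x y → CR L y z → CR L x z := fun x y z => CR_trans hL h4
  have hr := CR_refl hL hT
  obtain ⟨x0, hx0⟩ := hd (n + 1)
  obtain ⟨c, -, hc⟩ := chain_of_not_Dle n x0 hx0
  have hU : ∀ i, ∃ U : CW L → Prop, Dfn L U ∧ (∀ x y, CR L x y → U x → U y) ∧ U (c i) ∧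
      (i < n → ¬ U (c (i + 1))) := by
    intro i
    by_cases hi : i < n
    · obtain ⟨h1, h2⟩ := hc i hi
      simp only [CR, not_forall] at h2
      obtain ⟨γ, hγ, hγ'⟩ := h2
      refine ⟨fun x => MForm.box γ ∈ x.1, ⟨_, fun x => Iff.rfl⟩, ?_, hγ, ?_⟩
      · intro x y hxy hx
        rw [CW.box hL] at hx ⊢
        intro z hz
        exact hx z (ht _ _ _ hxy hz)
      · intro _ h
        exact hγ' (hr _ γ h)
    · exact ⟨fun _ => True, Dfn.true hL, fun _ _ _ _ => trivial, trivial, fun h => absurd h hi⟩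
  choose U hUd hUup hU1 hU2 using hU
  have hGd : ∀ i, Dfn L (Gs U i) := by
    intro i
    induction i with
    | zero => exact hUd 0
    | succ i ih => exact Dfn.or hL ih (hUd _)
  have hQd : ∀ i, Dfn L (Qs (CR L) U i) := by
    intro i
    induction i with
    | zero => exact hGd 0
    | succ i ih => exact Dfn.and hL (Dfn.and hL (hGd _) (Dfn.not hL (hGd _))) (Dfn.dia hL ih)
  have hGup : ∀ i x y, CR L x y → Gs U i x → Gs U i y := by
    intro i
    induction i with
    | zero => exact hUup 0
    | succ i ih =>
      intro x y hxy h
      rcases h with h | h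
      · exact Or.inl (ih x y hxy h)
      · exact Or.inr (hUup _ x y hxy h)
  have hGm : ∀ i j, i ≤ j → ∀ x, Gs U i x → Gs U j x := by
    intro i j hij x hx
    induction j, hij using Nat.le_induction with
    | base => exact hx
    | succ j _ ih => exact Or.inl ih
  have hQG : ∀ i x, Qs (CR L) U i x → Gs U i x := by
    intro i x h
    cases i with
    | zero => exact h
    | succ i => exact h.1.1
  have hcc : ∀ i j, j ≤ i → i ≤ n → CR L (c i) (c j) := by
    intro i j hij
    induction i, hij using Nat.le_induction with
    | base => intro _; exact hr _
    | succ i _ ih => intro hin; exact ht _ _ _ (hc i (by omega)).1 (ih (by omega))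
  have hcU : ∀ i j, j ≤ i → i < n → ¬ U j (c (i + 1)) := by
    intro i j hji hi h
    exact hU2 j (by omega) (hUup j _ _ (hcc (i + 1) (j + 1) (by omega) (by omega)) h)
  have hcG : ∀ i, i < n → ∀ j ≤ i, ¬ Gs U j (c (i + 1)) := by
    intro i hi j
    induction j with
    | zero => intro hj h; exact hcU i 0 hj hi h
    | succ j ih =>
      intro hj h
      rcases h with h | h
      · exact ih (by omega) h
      · exact hcU i _ hj hi h
  have hcQ : ∀ i, i ≤ n → Qs (CR L) U i (c i) := by
    intro i
    induction i with
    | zero => intro _; exact hU1 0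
    | succ i ih =>
      intro hi
      exact ⟨⟨Or.inr (hU1 _), hcG i (by omega) i le_rfl⟩, c i, (hc i (by omega)).1, ih (by omega)⟩
  let S : ℕ → CW L → Prop := fun i x => ∃ y, CR L x y ∧ Qs (CR L) U i y
  have hdown : ∀ i j, j ≤ i → ∀ x, Qs (CR L) U i x → S j x := by
    intro i j hij
    induction i, hij using Nat.le_induction with
    | base => intro x hx; exact ⟨x, hr x, hx⟩
    | succ i _ ih =>
      intro x hx
      obtain ⟨_, y, hy, hy'⟩ := hx
      obtain ⟨z, hz, hz'⟩ := ih y hy'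
      exact ⟨z, ht _ _ _ hy hz, hz'⟩
  let f0 : CW L → ℕ := fun x => Nat.findGreatest (fun i => S i x) n
  have hf0 : ∀ x, f0 x < n + 1 := fun x => Nat.lt_succ_of_le (Nat.findGreatest_le _)
  have hQf : ∀ i ≤ n, ∀ x, Qs (CR L) U i x → f0 x = i := by
    intro i hi x hx
    rw [Nat.findGreatest_eq_iff]
    refine ⟨hi, fun _ => ⟨x, hr x, hx⟩, ?_⟩
    rintro k hk _ ⟨y, hy, hy'⟩
    obtain ⟨k, rfl⟩ : ∃ k', k = k' + 1 := ⟨k - 1, by omega⟩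
    exact hy'.1.2 (hGm i k (by omega) y (hGup i x y hy (hQG i x hx)))
  have hpm : PM (CR L) Set.univ (fun a b : Fin (n + 1) => (b : ℕ) ≤ a) Set.univ
      (fun x => ⟨f0 x, hf0 x⟩) := by
    refine ⟨fun _ _ => trivial, ?_, ?_⟩
    · intro x _ y _ hxy
      show f0 y ≤ f0 x
      by_cases h : f0 y = 0
      · omega
      · obtain ⟨z, hz, hz'⟩ : S (f0 y) y := Nat.findGreatest_of_ne_zero (P := fun i => S i y) rfl h
        exact Nat.le_findGreatest (by have := hf0 y; omega) ⟨z, ht _ _ _ hxy hz, hz'⟩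
    · intro x _ v _ hv
      have hv' : (v : ℕ) ≤ f0 x := hv
      by_cases h : f0 x = 0
      · exact ⟨x, trivial, hr x, Fin.ext (by show f0 x = v; omega)⟩
      · obtain ⟨z, hz, hz'⟩ : S (f0 x) x := Nat.findGreatest_of_ne_zero (P := fun i => S i x) rfl h
        obtain ⟨y, hy, hy'⟩ := hdown (f0 x) v hv' z hz'
        exact ⟨y, trivial, ht _ _ _ hz hy, Fin.ext (hQf v (by have := v.2; omega) y hy')⟩
  refine vl_of_dfn hL (fun _ _ _ _ => trivial) hpm ?_ ?_
  · intro v _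
    exact ⟨c v, trivial, Fin.ext (hQf v (by have := v.2; omega) _ (hcQ v (by have := v.2; omega)))⟩
  · intro v
    have : Dfn L (fun x => ((v = (0 : ℕ)) ∨ S v x) ∧
        ∀ k : Fin (n + 1), ((v : ℕ) < k → ¬ S k x)) := by
      apply Dfn.and hL
      · exact Dfn.or hL (Dfn.const hL _) (Dfn.dia hL (hQd _))
      · exact Dfn.all hL (fun k => Dfn.imp hL (Dfn.const hL _) (Dfn.not hL (Dfn.dia hL (hQd _))))
    refine this.congr ?_
    intro x
    rw [Fin.ext_iff]
    show _ ↔ f0 x = v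
    rw [Nat.findGreatest_eq_iff]
    have hv := v.2
    constructor
    · rintro ⟨h1, h2⟩
      refine ⟨by omega, fun h => h1.resolve_left (fun h' => h h'), ?_⟩
      intro k hk hkn
      exact h2 ⟨k, by omega⟩ hk
    · rintro ⟨h1, h2, h3⟩
      refine ⟨?_, ?_⟩
      · by_cases h : (v : ℕ) = 0
        · exact Or.inl h
        · exact Or.inr (h2 h)
      · intro k hk
        exact h3 hk (by omega)
/-! ### Finite model property for finite depth -/

def Ty (n : ℕ) : ℕ → Type
  | 0 => Fin n → Prop
  | m + 1 => (Fin n → Prop) × Set (Ty n m)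

theorem Ty.finite (n m : ℕ) : Finite (Ty n m) := by
  induction m with
  | zero => show Finite (Fin n → Prop); infer_instance
  | succ m ih => show Finite ((Fin n → Prop) × Set (Ty n m)); infer_instance

def ty {W : Type} (R : W → W → Prop) {n : ℕ} (v : W → Fin n → Prop) : (m : ℕ) → W → Ty n m
  | 0, x => v x
  | m + 1, x => (v x, {t | ∃ y, R x y ∧ ty R v m y = t})

section Ty
variable {W : Type} {R : W → W → Prop} {n : ℕ} {v : W → Fin n → Prop}

theorem ty_succ (m : ℕ) (x y : W) : ty R v (m + 1) x = ty R v (m + 1) y ↔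
    v x = v y ∧ (∀ x', R x x' → ∃ y', R y y' ∧ ty R v m x' = ty R v m y') ∧
      (∀ y', R y y' → ∃ x', R x x' ∧ ty R v m x' = ty R v m y') := by
  have : ty R v (m + 1) x = ty R v (m + 1) y ↔ v x = v y ∧
      {t | ∃ z, R x z ∧ ty R v m z = t} = {t | ∃ z, R y z ∧ ty R v m z = t} := Prod.ext_iff
  rw [this]
  apply and_congr_right
  intro _
  rw [Set.ext_iff]
  constructor
  · intro h
    constructor
    · intro x' hx'
      obtain ⟨y', h1, h2⟩ := (h _).1 ⟨x', hx', rfl⟩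
      exact ⟨y', h1, h2.symm⟩
    · intro y' hy'
      obtain ⟨x', h1, h2⟩ := (h _).2 ⟨y', hy', rfl⟩
      exact ⟨x', h1, h2⟩
  · rintro ⟨h1, h2⟩ t
    constructor
    · rintro ⟨z, hz, rfl⟩
      obtain ⟨y', h3, h4⟩ := h1 z hz
      exact ⟨y', h3, h4.symm⟩
    · rintro ⟨z, hz, rfl⟩
      exact h2 z hz

theorem ty_v {m : ℕ} {x y : W} (h : ty R v m x = ty R v m y) : v x = v y := by
  cases m with
  | zero => exact h
  | succ m => exact ((ty_succ m x y).1 h).1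

theorem ty_pred {m : ℕ} {x y : W} (h : ty R v (m + 1) x = ty R v (m + 1) y) :
    ty R v m x = ty R v m y := by
  induction m generalizing x y with
  | zero => exact ty_v h
  | succ m ih =>
    obtain ⟨h1, h2, h3⟩ := (ty_succ (m + 1) x y).1 h
    refine (ty_succ m x y).2 ⟨h1, ?_, ?_⟩
    · intro x' hx'
      obtain ⟨y', hy, he⟩ := h2 x' hx'
      exact ⟨y', hy, ih he⟩
    · intro y' hy'
      obtain ⟨x', hx, he⟩ := h3 y' hy'
      exact ⟨x', hx, ih he⟩

theorem ty_all (ht : ∀ x y z, R x y → R y z → R x z) (k : ℕ) : ∀ x y : W, Dle R k x →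
    ty R v (3 * k) x = ty R v (3 * k) y → ∀ j, ty R v j x = ty R v j y := by
  induction k with
  | zero => intro x y h; exact h.elim
  | succ k IH =>
    intro x0 y0 hD h3
    obtain ⟨m, hm⟩ : ∃ m, m = 3 * k := ⟨_, rfl⟩
    have e3 : 3 * (k + 1) = m + 2 + 1 := by omega
    rw [e3] at h3
    rw [← hm] at IH
    have h2 := ty_pred h3
    have h1 := ty_pred h2
    obtain ⟨-, s3, b3⟩ := (ty_succ (m + 2) x0 y0).1 h3
    obtain ⟨-, s2, b2⟩ := (ty_succ (m + 1) x0 y0).1 h2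
    suffices H : ∀ j a b, (a = x0 ∨ (R x0 a ∧ R a x0)) → (b = y0 ∨ R y0 b) →
        ty R v (m + 1) a = ty R v (m + 1) b → ty R v j a = ty R v j b from
      fun j => H j x0 y0 (Or.inl rfl) (Or.inl rfl) h1
    intro j
    induction j with
    | zero => intro a b _ _ h; exact ty_v h
    | succ j ih =>
      intro a b ha hb hab
      obtain ⟨va, sa, ba⟩ := (ty_succ m a b).1 hab
      refine (ty_succ j a b).2 ⟨va, ?_, ?_⟩
      · intro a' haa'
        have hx0a' : R x0 a' := by
          rcases ha with rfl | ha
          · exact haa'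
          · exact ht _ _ _ ha.1 haa'
        by_cases hC : R a' x0
        · suffices hs : ∃ b', R b b' ∧ ty R v (m + 1) a' = ty R v (m + 1) b' by
            obtain ⟨b', hb', he⟩ := hs
            refine ⟨b', hb', ih a' b' (Or.inr ⟨hx0a', hC⟩) (Or.inr ?_) he⟩
            rcases hb with rfl | hb
            · exact hb'
            · exact ht _ _ _ hb hb'
          rcases hb with rfl | hb
          · exact s2 a' hx0a'
          · obtain ⟨z, hz, hzb⟩ := b3 b hb
            have hz1 : ∃ z', R z z' ∧ ty R v (m + 1) z' = ty R v (m + 1) a' := by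
              by_cases hzC : R z x0
              · exact ⟨a', ht _ _ _ hzC hx0a', rfl⟩
              · have hza : ty R v m z = ty R v m a := by
                  rw [ty_pred hab]; exact ty_pred (ty_pred hzb)
                have := IH z a (hD z hz hzC) hza (m + 2)
                obtain ⟨z', hz', he⟩ := ((ty_succ (m + 1) z a).1 this).2.2 a' haa'
                exact ⟨z', hz', he⟩
            obtain ⟨z', hz', he⟩ := hz1
            obtain ⟨b', hb', he'⟩ := ((ty_succ (m + 1) z b).1 hzb).2.1 z' hz'
            exact ⟨b', hb', he.symm.trans he'⟩
        · obtain ⟨b', hb', he⟩ := sa a' haa'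
          exact ⟨b', hb', IH a' b' (hD a' hx0a' hC) he j⟩
      · intro b' hbb'
        have hy0b' : R y0 b' := by
          rcases hb with rfl | hb
          · exact hbb'
          · exact ht _ _ _ hb hbb'
        obtain ⟨z, hz, hzb⟩ := b3 b' hy0b'
        by_cases hzC : R z x0
        · refine ⟨z, ?_, ih z b' (Or.inr ⟨hz, hzC⟩) (Or.inr hy0b') (ty_pred hzb)⟩
          rcases ha with rfl | ha
          · exact hz
          · exact ht _ _ _ ha.2 hz
        · obtain ⟨a', ha', he⟩ := ba b' hbb'
          refine ⟨a', ha', ?_⟩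
          have hzm := ty_pred (ty_pred hzb)
          have hDz := hD z hz hzC
          rw [← IH z a' hDz (hzm.trans he.symm) j, IH z b' hDz hzm j]

end Ty

theorem ty_dfn {L : Set (MForm ℕ)} (hL : IsNormal L) (n m : ℕ) (t : Ty n m) :
    Dfn L (fun x => ty (CR L) (fun (x : CW L) (i : Fin n) => MForm.atom (i : ℕ) ∈ x.1) m x = t) := by
  have hv : ∀ t : Fin n → Prop, Dfn L (fun x => (fun (i : Fin n) => MForm.atom (i : ℕ) ∈ x.1) = t) := by
    intro t
    have : Dfn L (fun x => ∀ i : Fin n, (MForm.atom (i : ℕ) ∈ x.1 → t i) ∧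
        (t i → MForm.atom (i : ℕ) ∈ x.1)) := by
      refine Dfn.all hL (fun i => ?_)
      have h1 : Dfn L (fun x => MForm.atom (i : ℕ) ∈ x.1) := ⟨_, fun x => Iff.rfl⟩
      exact Dfn.and hL (Dfn.imp hL h1 (Dfn.const hL _)) (Dfn.imp hL (Dfn.const hL _) h1)
    refine this.congr (fun x => ?_)
    rw [funext_iff]
    exact forall_congr' (fun i => ⟨fun h => propext ⟨h.1, h.2⟩, fun h => ⟨h.mp, h.mpr⟩⟩)
  induction m with
  | zero => exact hv t
  | succ m ih =>
    obtain ⟨t1, T⟩ := t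
    have := Ty.finite n m
    have h2 : Dfn L (fun x => ∀ s : Ty n m, ((∃ y, CR L x y ∧
        ty (CR L) (fun (x : CW L) (i : Fin n) => MForm.atom (i : ℕ) ∈ x.1) m y = s) → s ∈ T) ∧
        (s ∈ T → ∃ y, CR L x y ∧
        ty (CR L) (fun (x : CW L) (i : Fin n) => MForm.atom (i : ℕ) ∈ x.1) m y = s)) := by
      refine Dfn.all hL (fun s => ?_)
      have h1 := Dfn.dia hL (ih s)
      exact Dfn.and hL (Dfn.imp hL h1 (Dfn.const hL _)) (Dfn.imp hL (Dfn.const hL _) h1)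
    refine (Dfn.and hL (hv t1) h2).congr (fun x => ?_)
    refine Iff.trans ?_ (Iff.symm (Prod.ext_iff))
    refine and_congr Iff.rfl ?_
    refine Iff.trans ?_ (Iff.symm Set.ext_iff)
    exact forall_congr' (fun s => iff_def.symm)

theorem Dle.image {W₁ W₂ : Type} {R₁ : W₁ → W₁ → Prop} {R₂ : W₂ → W₂ → Prop} {f : W₁ → W₂}
    (h : PM R₁ Set.univ R₂ Set.univ f) (k : ℕ) : ∀ x, Dle R₁ k x → Dle R₂ k (f x) := by
  induction k with
  | zero => intro x h; exact h
  | succ k ih =>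
    intro x hx s hs hs'
    obtain ⟨y, -, hy, rfl⟩ := h.back x trivial s trivial hs
    exact ih y (hx y hy (fun h' => hs' (h.forth _ trivial _ trivial h')))

theorem Dle.sub {W : Type} {R : W → W → Prop} {G : Set W} (k : ℕ) : ∀ x : G, Dle R k x.1 →
    Dle (fun a b : G => R a.1 b.1) k x := by
  induction k with
  | zero => intro x h; exact h
  | succ k ih => intro x hx y hy hy'; exact ih y (hx y hy hy')

theorem pm_up {W : Type} {R : W → W → Prop} (ht : ∀ x y z, R x y → R y z → R x z) (r : W) :
    PM (fun a b : {y | y = r ∨ R r y} => R a.1 b.1) Set.univ R Set.univ (fun a => a.1) := by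
  refine ⟨fun _ _ => trivial, fun _ _ _ _ h => h, ?_⟩
  rintro ⟨x, hx⟩ _ v _ hv
  refine ⟨⟨v, Or.inr ?_⟩, trivial, hv, rfl⟩
  rcases hx with rfl | hx
  · exact hv
  · exact ht _ _ _ hx hv

theorem fd {L : Set (MForm ℕ)} (hL : IsNormal L)
    (h4 : ∀ φ : MForm ℕ, (MForm.box φ).imp (MForm.box (MForm.box φ)) ∈ L) {d : ℕ}
    (hd : ∀ x : CW L, Dle (CR L) d x) (hnt : ¬ Tabular L) (N : ℕ) :
    ∃ (W : Type) (R : W → W → Prop) (r : W), Finite W ∧ VL R Set.univ L ∧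
      (∀ x, Dle R d x) ∧ (∀ y, y = r ∨ R r y) ∧ N < Nat.card W := by
  classical
  by_contra hcon
  push Not at hcon
  apply hnt
  let ι : Type := {i : Σ k : Fin (N + 1), (Fin k → Fin k → Prop) × Fin k // VL i.2.1 Set.univ L}
  refine ⟨ι, Fintype.ofFinite _, fun i => ⟨⟨Fin i.1.1, ⟨i.1.2.2⟩, i.1.2.1⟩, i.1.2.2⟩,
    fun i => (inferInstance : Finite (Fin i.1.1)), ?_⟩
  apply Set.Subset.antisymm
  · rintro φ hφ P ⟨i, rfl⟩ V
    rw [sat_iff_satOn]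
    exact i.2 φ hφ V _ trivial
  · intro φ hφ
    by_contra hφL
    obtain ⟨x, hx⟩ := exists_CW hL hφL
    have hCt : ∀ x y z : CW L, CR L x y → CR L y z → CR L x z := fun x y z => CR_trans hL h4
    let n := φ.sig.sup id + 1
    have hn : ∀ p ∈ φ.sig, p < n := fun p hp =>
      Nat.lt_succ_of_le (Finset.le_sup (f := id) hp)
    let v : CW L → Fin n → Prop := fun x i => MForm.atom (i : ℕ) ∈ x.1
    let f0 : CW L → Ty n (3 * d) := ty (CR L) v (3 * d)
    have := Ty.finite n (3 * d)
    let Y : Type := Set.range f0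
    let f : CW L → Y := fun x => ⟨f0 x, x, rfl⟩
    have hf : ∀ x y, f x = f y → ∀ j, ty (CR L) v j x = ty (CR L) v j y := by
      intro x y hxy
      exact ty_all hCt d x y (hd x) (Subtype.ext_iff.1 hxy)
    have hsurj : ∀ t : Y, ∃ x, f x = t := by
      rintro ⟨_, x, rfl⟩; exact ⟨x, rfl⟩
    let R : Y → Y → Prop := fun s t => ∃ a b, f a = s ∧ f b = t ∧ CR L a b
    have hpm : PM (CR L) Set.univ R Set.univ f := by
      refine ⟨fun _ _ => trivial, fun a _ b _ h => ⟨a, b, rfl, rfl, h⟩, ?_⟩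
      rintro a _ _ _ ⟨a', b, h1, rfl, h2⟩
      have := hf a' a h1 (3 * d + 1)
      obtain ⟨b', hb', he⟩ := ((ty_succ (3 * d) a' a).1 this).2.1 b h2
      exact ⟨b', trivial, hb', Subtype.ext he.symm⟩
    have hvl : VL R Set.univ L := by
      refine vl_of_dfn hL (fun _ _ _ _ => trivial) hpm (fun t _ => ?_) ?_
      · obtain ⟨x, hx⟩ := hsurj t; exact ⟨x, trivial, hx⟩
      · intro t
        exact (ty_dfn hL n (3 * d) t.1).congr (fun x => ⟨fun h => Subtype.ext h, fun h => congrArg Subtype.val h⟩)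
    have hRD : ∀ t, Dle R d t := by
      intro t
      obtain ⟨x, rfl⟩ := hsurj t
      exact Dle.image hpm d x (hd x)
    have hRt : ∀ x y z, R x y → R y z → R x z := fun x y z =>
      trans_of_VL h4 hvl x trivial y trivial z trivial
    let V₂ : Y → ℕ → Prop := fun t p => ∃ y, f y = t ∧ MForm.atom p ∈ y.1
    have hns : ¬ satOn R Set.univ V₂ (f x) φ := by
      rw [← hpm.sat (V₁ := fun w p => MForm.atom p ∈ w.1) φ ?_ x trivial, CW.truth hL]
      · exact hx
      · intro p hp w _
        constructor
        · intro h; exact ⟨w, rfl, h⟩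
        · rintro ⟨y, hy, h⟩
          have := ty_v (hf y w hy 0)
          have := congrFun this ⟨p, hn p hp⟩
          exact this.mp h
    let G : Set Y := {y | y = f x ∨ R (f x) y}
    have hpm2 : PM (fun a b : G => R a.1 b.1) Set.univ R Set.univ (fun a => a.1) := pm_up hRt (f x)
    have hvl2 := hpm2.vl_inj Subtype.val_injective hvl
    have hcard := hcon G (fun a b : G => R a.1 b.1) ⟨f x, Or.inl rfl⟩ inferInstance hvl2
      (fun y => Dle.sub d y (hRD y.1)) (fun y => y.2.imp (fun h => Subtype.ext h) id)
    obtain ⟨e⟩ : Nonempty (G ≃ Fin (Nat.card G)) := ⟨Finite.equivFin G⟩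
    have hee : ∀ b, e.symm (e b) = b := e.symm_apply_apply
    have hpm3 : PM (fun a b => R (e.symm a).1 (e.symm b).1) Set.univ (fun a b : G => R a.1 b.1)
        Set.univ (fun a => e.symm a) := by
      refine ⟨fun _ _ => trivial, fun _ _ _ _ h => h, ?_⟩
      intro a _ b _ h
      exact ⟨e b, trivial, by rw [hee]; exact h, hee b⟩
    have hvl3 := hpm3.vl_inj e.symm.injective hvl2
    have := hφ _ ⟨⟨⟨⟨Nat.card G, by omega⟩, ⟨fun a b => R (e.symm a).1 (e.symm b).1,
      e ⟨f x, Or.inl rfl⟩⟩⟩, hvl3⟩, rfl⟩ (fun a p => V₂ (e.symm a).1 p)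
    rw [sat_iff_satOn] at this
    apply hns
    have h5 := (hpm3.sat (V₁ := fun a p => V₂ (e.symm a).1 p) (V₂ := fun a p => V₂ a.1 p) φ
      (fun _ _ _ _ => Iff.rfl) _ trivial).1 this
    have h6 := (hpm2.sat (V₁ := fun a p => V₂ a.1 p) (V₂ := V₂) φ
      (fun _ _ _ _ => Iff.rfl) _ trivial).1 h5
    rw [hee] at h6
    exact h6
/-! ### Clusters -/

theorem exists_fin_inj {W : Type} {A : Set W} {N : ℕ} (hA : A.Finite) (h : N + 1 ≤ A.ncard) :
    ∃ y : Fin (N + 1) → W, Function.Injective y ∧ ∀ i, y i ∈ A := by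
  have hf : Finite A := hA
  rw [← Nat.card_coe_set_eq] at h
  obtain ⟨e⟩ : Nonempty (A ≃ Fin (Nat.card A)) := ⟨Finite.equivFin A⟩
  refine ⟨fun i => (e.symm (Fin.castLE h i)).1, ?_, fun i => (e.symm _).2⟩
  intro i j hij
  exact Fin.castLE_injective h (e.symm.injective (Subtype.ext hij))

theorem wide_of_clusters {L : Set (MForm ℕ)}
    (h4 : ∀ φ : MForm ℕ, (MForm.box φ).imp (MForm.box (MForm.box φ)) ∈ L)
    (hT : ∀ φ : MForm ℕ, (MForm.box φ).imp φ ∈ L)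
    (h : ∀ N : ℕ, ∃ (W : Type) (R : W → W → Prop) (c : W), Finite W ∧ VL R Set.univ L ∧
      N < {y | R c y ∧ R y c}.ncard) : Wide L := by
  classical
  refine ⟨1, fun N => ?_⟩
  obtain ⟨W, R, c, hfin, hvl, hN⟩ := h N
  have ht : ∀ x y z, R x y → R y z → R x z := fun x y z =>
    trans_of_VL h4 hvl x trivial y trivial z trivial
  have hr : ∀ x, R x x := fun x => refl_of_VL hT hvl x trivial
  set C : Set W := {y | R c y ∧ R y c} with hC
  let T : Set W := {y | R c y ∧ ¬ R y c}
  obtain ⟨t, htT⟩ : ∃ t, T.Nonempty → t ∈ T := by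
    by_cases hne : T.Nonempty
    · exact ⟨hne.choose, fun _ => hne.choose_spec⟩
    · exact ⟨c, fun h => absurd h hne⟩
  let E : Set W := {z | z = t ∧ z ∈ T}
  have hcC : c ∈ C := ⟨hr c, hr c⟩
  have hEC : (E ∪ C) \ C = E := by
    ext z
    constructor
    · rintro ⟨h1 | h1, h2⟩
      · exact h1
      · exact absurd h1 h2
    · intro hz
      exact ⟨Or.inl hz, fun h => hz.2.2 h.2⟩
  refine ⟨W, R, E ∪ C, C, c, ⟨Set.toFinite _, Set.subset_union_right, ⟨c, hcC⟩, ?_, ?_, ?_⟩,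
    Or.inr hcC, ?_⟩
  · rw [hEC]
    calc E.ncard ≤ ({t} : Set W).ncard := Set.ncard_le_ncard (fun z hz => hz.1) (Set.toFinite _)
      _ = 1 := Set.ncard_singleton t
  · intro X hX ⟨a, ha⟩
    refine ⟨a, ha, fun y _ b hb hyb => Or.inr ?_⟩
    exact ht _ _ _ hyb (ht _ _ _ (hX hb).2 (hX ha).1)
  · intro A' hA' ⟨a0, ha0⟩
    rw [hEC]
    let P : Set W := {y | R c y}
    have hP : VL R P L := hvl.gen (fun _ _ => trivial) (fun x hx y _ hxy => ht _ _ _ hx hxy)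
    let g : W → W := fun x => if x ∈ T then t else if x ∈ A' then x else a0
    have gT : ∀ x ∈ T, g x = t := fun x hx => if_pos hx
    have gA : ∀ x ∈ A', g x = x := fun x hx => by
      have : x ∉ T := fun h => h.2 (hA' hx).2
      simp only [g, this, hx, if_true, if_false]
    have gC : ∀ x ∉ T, g x ∈ A' := fun x hx => by
      by_cases h : x ∈ A'
      · rw [gA x h]; exact h
      · simp only [g, hx, h, if_false]; exact ha0
    have gE : ∀ x ∈ T, g x ∈ E := fun x hx => by
      rw [gT x hx]; exact ⟨rfl, htT ⟨x, hx⟩⟩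
    have gcU : ∀ x ∈ P, R c (g x) := fun x hx => by
      by_cases h : x ∈ T
      · exact (gE x h).2.1
      · exact (hA' (gC x h)).1
    have gv : ∀ v ∈ E ∪ A', g v = v := by
      rintro v (hv | hv)
      · rw [gT v hv.2]; exact hv.1.symm
      · exact gA v hv
    have vP : ∀ v ∈ E ∪ A', v ∈ P := by
      rintro v (hv | hv)
      · exact hv.2.1
      · exact (hA' hv).1
    have hpm : PM R P R (E ∪ A') g := by
      refine ⟨?_, ?_, ?_⟩
      · intro x hx
        by_cases h : x ∈ T
        · exact Or.inl (gE x h)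
        · exact Or.inr (gC x h)
      · intro x hx y hy hxy
        by_cases h : x ∈ T
        · have : y ∈ T := ⟨hy, fun h' => h.2 (ht _ _ _ hxy h')⟩
          rw [gT x h, gT y this]; exact hr t
        · exact ht _ _ _ (hA' (gC x h)).2 (gcU y hy)
      · intro x hx v hv hxv
        by_cases h : x ∈ T
        · refine ⟨x, hx, hr x, ?_⟩
          rcases hv with hv | hv
          · rw [gT x h]; exact hv.1.symm
          · exact absurd (ht _ _ _ hxv (hA' hv).2) (gE x h).2.2
        · have hxc : R x c := by
            by_contra h'
            exact h ⟨hx, h'⟩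
          exact ⟨v, vP v hv, ht _ _ _ hxc (vP v hv), gv v hv⟩
    exact hpm.vl (fun v hv => ⟨v, vP v hv, gv v hv⟩) hP
  · obtain ⟨y, hy, hy'⟩ := exists_fin_inj (Set.toFinite C) hN
    exact ⟨y, hy, fun i => ⟨Or.inr (hy' i), (hy' i).1⟩⟩

/-! ### Posets -/

structure PO (L : Set (MForm ℕ)) (d : ℕ) {W : Type} (R : W → W → Prop) (Q : Set W) (r : W)
    (l : W → ℕ) : Prop where
  fin : Q.Finite
  rQ : r ∈ Q
  root : ∀ y ∈ Q, y = r ∨ R r y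
  hom : (∀ x ∈ Q, R x x) ∨ (∀ x ∈ Q, ¬ R x x)
  dec : ∀ x ∈ Q, ∀ y ∈ Q, R x y → x ≠ y → l y < l x
  bd : ∀ x ∈ Q, l x < d
  vl : VL R Q L

theorem exists_rep {W κ : Type} (Λ : Set W) (K : W → κ) : ∃ ρ : W → W,
    (∀ x ∈ Λ, ρ x ∈ Λ ∧ K (ρ x) = K x) ∧ (∀ x ∈ Λ, ∀ y ∈ Λ, K x = K y → ρ x = ρ y) := by
  classical
  by_cases hne : Λ.Nonempty
  · obtain ⟨w, _⟩ := hne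
    let c : κ → W := fun t => if h : ∃ z ∈ Λ, K z = t then h.choose else w
    refine ⟨fun x => c (K x), ?_, fun x _ y _ h => by simp only [h]⟩
    intro x hx
    have h : ∃ z ∈ Λ, K z = K x := ⟨x, hx, rfl⟩
    have : c (K x) = h.choose := dif_pos h
    simp only [this]
    exact h.choose_spec
  · exact ⟨id, fun x hx => absurd ⟨x, hx⟩ hne, fun x hx => absurd ⟨x, hx⟩ hne⟩

noncomputable def lev {W : Type} (R : W → W → Prop) (x : W) : ℕ := sInf {k | Dle R (k + 1) x}

theorem lev_spec {W : Type} {R : W → W → Prop} {d : ℕ} {x : W} (h : Dle R d x) :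
    lev R x < d ∧ Dle R (lev R x + 1) x := by
  cases d with
  | zero => exact h.elim
  | succ d =>
    have h1 : d ∈ {k | Dle R (k + 1) x} := h
    exact ⟨Nat.lt_succ_of_le (Nat.sInf_le h1), Nat.sInf_mem ⟨d, h1⟩⟩

theorem lev_lt {W : Type} {R : W → W → Prop} {d : ℕ} {x y : W} (h : Dle R d x) (hxy : R x y)
    (hyx : ¬ R y x) : lev R y < lev R x :=
  (lev_spec ((lev_spec h).2 y hxy hyx)).1

/-- Either clusters are unbounded, or posets of unbounded size exist. -/
theorem po_of_clusters {L : Set (MForm ℕ)} {d B : ℕ}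
    (h4 : ∀ φ : MForm ℕ, (MForm.box φ).imp (MForm.box (MForm.box φ)) ∈ L)
    (hT : ∀ φ : MForm ℕ, (MForm.box φ).imp φ ∈ L)
    (hB : ∀ (W : Type) (R : W → W → Prop) (c : W), Finite W → VL R Set.univ L →
      {y | R c y ∧ R y c}.ncard ≤ B)
    (h : ∀ N : ℕ, ∃ (W : Type) (R : W → W → Prop) (r : W), Finite W ∧ VL R Set.univ L ∧
      (∀ x, Dle R d x) ∧ (∀ y, y = r ∨ R r y) ∧ N < Nat.card W) (N : ℕ) :
    ∃ (W : Type) (R : W → W → Prop) (Q : Set W) (r : W) (l : W → ℕ), PO L d R Q r l ∧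
      N < Q.ncard := by
  classical
  obtain ⟨W, R, r, hfin, hvl, hd, hroot, hN⟩ := h (B * N)
  have ht : ∀ x y z, R x y → R y z → R x z := fun x y z =>
    trans_of_VL h4 hvl x trivial y trivial z trivial
  have hr : ∀ x, R x x := fun x => refl_of_VL hT hvl x trivial
  obtain ⟨g, hg1, hg2⟩ := exists_rep (Set.univ : Set W) (fun x => {y | R x y ∧ R y x})
  have hgx : ∀ x, R x (g x) ∧ R (g x) x := by
    intro x
    have h1 := (hg1 x trivial).2
    have h2 : x ∈ {y | R (g x) y ∧ R y (g x)} := by rw [h1]; exact ⟨hr x, hr x⟩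
    exact ⟨h2.2, h2.1⟩
  have hge : ∀ x y, R x y → R y x → g x = g y := by
    intro x y h1 h2
    apply hg2 x trivial y trivial
    ext z
    exact ⟨fun h => ⟨ht _ _ _ h2 h.1, ht _ _ _ h.2 h1⟩, fun h => ⟨ht _ _ _ h1 h.1, ht _ _ _ h.2 h2⟩⟩
  have hgg : ∀ x, g (g x) = g x := fun x => hge _ _ (hgx x).2 (hgx x).1
  have hpm : PM R Set.univ R (Set.range g) g := by
    refine ⟨fun x _ => ⟨x, rfl⟩, fun x _ y _ h => ht _ _ _ (hgx x).2 (ht _ _ _ h (hgx y).1), ?_⟩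
    rintro x _ _ ⟨y, rfl⟩ h
    exact ⟨g y, trivial, ht _ _ _ (hgx x).1 h, hgg y⟩
  refine ⟨W, R, Set.range g, g r, lev R, ⟨Set.toFinite _, ⟨r, rfl⟩, ?_, Or.inl (fun x _ => hr x), ?_,
    fun x _ => (lev_spec (hd x)).1, hpm.vl (by rintro _ ⟨x, rfl⟩; exact ⟨x, trivial, rfl⟩) hvl⟩, ?_⟩
  · intro y _
    right
    rcases hroot y with rfl | h1
    · exact (hgx y).2
    · exact ht _ _ _ (hgx r).2 h1
  · rintro _ ⟨x, rfl⟩ _ ⟨y, rfl⟩ h1 h2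
    refine lev_lt (hd _) h1 (fun h3 => h2 ?_)
    rw [← hgg x, ← hgg y]
    exact hge _ _ h1 h3
  · have := Fintype.ofFinite W
    have h1 := Finset.card_le_mul_card_image (f := g) Finset.univ B (by
      intro a _
      have := hB W R a hfin hvl
      refine le_trans ?_ this
      rw [← Set.ncard_coe_finset]
      apply Set.ncard_le_ncard _ (Set.toFinite _)
      intro x hx
      have hx' : g x = a := by simpa using hx
      subst hx'
      exact (hgx x).symm)
    have h2 : (Set.range g).ncard = (Finset.univ.image g).card := by
      rw [← Set.ncard_coe_finset]
      congr 1
      ext; simp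
    rw [Finset.card_univ, ← Nat.card_eq_fintype_card, ← h2] at h1
    by_contra hcon
    have : B * (Set.range g).ncard ≤ B * N := Nat.mul_le_mul_left _ (not_lt.1 hcon)
    omega

theorem po_of_irrefl {L : Set (MForm ℕ)} {d : ℕ}
    (h4 : ∀ φ : MForm ℕ, (MForm.box φ).imp (MForm.box (MForm.box φ)) ∈ L)
    (hlob : ∀ φ : MForm ℕ, (MForm.box ((MForm.box φ).imp φ)).imp (MForm.box φ) ∈ L)
    (h : ∀ N : ℕ, ∃ (W : Type) (R : W → W → Prop) (r : W), Finite W ∧ VL R Set.univ L ∧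
      (∀ x, Dle R d x) ∧ (∀ y, y = r ∨ R r y) ∧ N < Nat.card W) (N : ℕ) :
    ∃ (W : Type) (R : W → W → Prop) (Q : Set W) (r : W) (l : W → ℕ), PO L d R Q r l ∧
      N < Q.ncard := by
  obtain ⟨W, R, r, hfin, hvl, hd, hroot, hN⟩ := h N
  have hir := irrefl_of_VL hlob hvl
  refine ⟨W, R, Set.univ, r, lev R, ⟨Set.toFinite _, trivial, fun y _ => hroot y,
    Or.inr hir, ?_, fun x _ => (lev_spec (hd x)).1, hvl⟩, by rwa [Set.ncard_univ]⟩
  intro x _ y _ h1 _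
  exact lev_lt (hd x) h1 (fun h2 => hir x trivial
    (trans_of_VL h4 hvl x trivial y trivial x trivial h1 h2))
/-! ### Combinatorics of posets of bounded depth -/

theorem po_collapse {L : Set (MForm ℕ)} {d k B : ℕ} {W : Type} {R : W → W → Prop} {Q : Set W} {r : W}
    {l : W → ℕ} (h : PO L d R Q r l) (hB : {x | x ∈ Q ∧ l x < k}.ncard ≤ B) :
    ∃ (R' : W → W → Prop) (Q' : Set W) (r' : W), PO L d R' Q' r' l ∧
      {x | x ∈ Q' ∧ l x < k + 1}.ncard ≤ B + 2 ^ B ∧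
      (Q \ {x | x ∈ Q ∧ l x = k}).ncard ≤ Q'.ncard := by
  classical
  set Λ : Set W := {x | x ∈ Q ∧ l x = k} with hΛ
  set D : Set W := {x | x ∈ Q ∧ l x < k} with hD
  have hDf : D.Finite := h.fin.subset (fun x hx => hx.1)
  let S : W → Set W := fun x => {y | y ∈ Q ∧ R x y ∧ y ≠ x}
  obtain ⟨ρ, hρ1, hρ2⟩ := exists_rep Λ S
  let g : W → W := fun x => if x ∈ Λ then ρ x else x
  have gΛ : ∀ x ∈ Λ, g x = ρ x := fun x hx => if_pos hx
  have gn : ∀ x ∉ Λ, g x = x := fun x hx => if_neg hx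
  have gQ : ∀ x ∈ Q, g x ∈ Q := fun x hx => by
    by_cases hxΛ : x ∈ Λ
    · rw [gΛ x hxΛ]; exact (hρ1 x hxΛ).1.1
    · rw [gn x hxΛ]; exact hx
  have gl : ∀ x, l (g x) = l x := fun x => by
    by_cases hxΛ : x ∈ Λ
    · rw [gΛ x hxΛ, (hρ1 x hxΛ).1.2, hxΛ.2]
    · rw [gn x hxΛ]
  have gS : ∀ x, S (g x) = S x := fun x => by
    by_cases hxΛ : x ∈ Λ
    · rw [gΛ x hxΛ, (hρ1 x hxΛ).2]
    · rw [gn x hxΛ]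
  have gg : ∀ x, g (g x) = g x := fun x => by
    by_cases hxΛ : x ∈ Λ
    · rw [gΛ x hxΛ, gΛ _ (hρ1 x hxΛ).1]
      exact hρ2 _ (hρ1 x hxΛ).1 _ hxΛ (hρ1 x hxΛ).2
    · rw [gn x hxΛ, gn x hxΛ]
  have hall : ∀ x ∈ Q, R x x → ∀ y ∈ Q, R y y := by
    intro x hx hxx
    rcases h.hom with h1 | h1
    · exact h1
    · exact absurd hxx (h1 x hx)
  let R' : W → W → Prop := fun a b => ∃ z ∈ Q, g z = b ∧ R a z
  have hforth : ∀ x ∈ Q, ∀ y ∈ Q, R x y → R' (g x) (g y) := by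
    intro x hx y hy hxy
    by_cases hyx : y = x
    · subst hyx
      exact ⟨g y, gQ y hy, gg y, hall y hy hxy _ (gQ y hy)⟩
    · have : y ∈ S (g x) := by rw [gS]; exact ⟨hy, hxy, hyx⟩
      exact ⟨y, hy, rfl, this.2.1⟩
  have hpm : PM R Q R' (g '' Q) g := by
    refine ⟨fun x hx => ⟨x, hx, rfl⟩, hforth, ?_⟩
    rintro x hx v - ⟨z, hz, rfl, hxz⟩
    by_cases hzx : z = g x
    · subst hzx
      exact ⟨x, hx, hall _ hz hxz x hx, (gg x).symm⟩
    · have : z ∈ S x := by rw [← gS]; exact ⟨hz, hxz, hzx⟩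
      exact ⟨z, hz, this.2.1, rfl⟩
  have hQ' : ∀ a ∈ g '' Q, a ∈ Q ∧ g a = a := by
    rintro _ ⟨x, hx, rfl⟩
    exact ⟨gQ x hx, gg x⟩
  refine ⟨R', g '' Q, g r, ⟨h.fin.image g, ⟨r, h.rQ, rfl⟩, ?_, ?_, ?_, ?_, ?_⟩, ?_, ?_⟩
  · rintro _ ⟨w, hw, rfl⟩
    rcases h.root w hw with rfl | h1
    · exact Or.inl rfl
    · exact Or.inr (hforth r h.rQ w hw h1)
  · rcases h.hom with h1 | h1
    · left
      intro a ha
      obtain ⟨h2, h3⟩ := hQ' a ha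
      exact ⟨a, h2, h3, h1 a h2⟩
    · right
      rintro a ha ⟨z, hz, hza, haz⟩
      obtain ⟨h2, h3⟩ := hQ' a ha
      by_cases hne : a = z
      · subst hne; exact h1 a h2 haz
      · have := h.dec a h2 z hz haz hne
        have h5 := gl z
        rw [hza] at h5
        omega
  · rintro a ha b - ⟨z, hz, hzb, haz⟩ hab
    obtain ⟨h2, h3⟩ := hQ' a ha
    have hne : a ≠ z := by
      rintro rfl
      exact hab (h3.symm.trans hzb)
    have := h.dec a h2 z hz haz hne
    have h5 := gl z
    rw [hzb] at h5
    omega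
  · intro x hx
    exact h.bd x (hQ' x hx).1
  · exact hpm.vl (fun v hv => hv) h.vl
  · have hsub : {x | x ∈ g '' Q ∧ l x < k + 1} ⊆ D ∪ g '' Λ := by
      rintro x ⟨hx, hlx⟩
      obtain ⟨h2, h3⟩ := hQ' x hx
      rcases Nat.lt_or_ge (l x) k with h4 | h4
      · exact Or.inl ⟨h2, h4⟩
      · exact Or.inr ⟨x, ⟨h2, by omega⟩, h3⟩
    have hΛf : Λ.Finite := h.fin.subset (fun x hx => hx.1)
    have h1 : (g '' Λ).ncard ≤ (𝒫 D).ncard := by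
      refine Set.ncard_le_ncard_of_injOn S ?_ ?_ hDf.powerset
      · rintro _ ⟨x, hx, rfl⟩
        rw [gS]
        rintro y ⟨hy, hxy, hyx⟩
        refine ⟨hy, ?_⟩
        have := h.dec x hx.1 y hy hxy (Ne.symm hyx)
        have h6 := hx.2
        omega
      · rintro _ ⟨x, hx, rfl⟩ _ ⟨y, hy, rfl⟩ hxy
        rw [gS, gS] at hxy
        rw [gΛ x hx, gΛ y hy]
        exact hρ2 x hx y hy hxy
    rw [Set.ncard_powerset D hDf] at h1
    have h2 : 2 ^ D.ncard ≤ 2 ^ B := Nat.pow_le_pow_right (by norm_num) hB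
    calc _ ≤ (D ∪ g '' Λ).ncard := Set.ncard_le_ncard hsub (hDf.union (hΛf.image g))
      _ ≤ D.ncard + (g '' Λ).ncard := Set.ncard_union_le _ _
      _ ≤ B + 2 ^ B := by omega
  · apply Set.ncard_le_ncard _ (h.fin.image g)
    rintro x ⟨hx, hxΛ⟩
    exact ⟨x, hx, gn x hxΛ⟩

theorem po_kf {L : Set (MForm ℕ)} {d k M N : ℕ} {W : Type} {R : W → W → Prop} {Q : Set W} {r : W}
    {l : W → ℕ} (h : PO L d R Q r l) (hM : (Q \ {x | x ∈ Q ∧ l x = k}).ncard ≤ M)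
    (hN : M + (2 ^ M * 2 ^ M) * (N + 2) < Q.ncard) :
    ∃ (A E : Set W), KF L (M + 2 ^ M * 2 ^ M) R (E ∪ A) A ∧ r ∈ E ∪ A ∧
      ∃ y : Fin (N + 1) → W, Function.Injective y ∧ ∀ i, y i ∈ E ∪ A ∧ R r (y i) := by
  classical
  set Λ : Set W := {x | x ∈ Q ∧ l x = k} with hΛ
  set H : Set W := Q \ Λ with hH
  have hHf : H.Finite := h.fin.subset (fun x hx => hx.1)
  have hΛf : Λ.Finite := h.fin.subset (fun x hx => hx.1)
  have hdich : ∀ x ∈ Q, x ∈ H ∨ x ∈ Λ := fun x hx => by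
    by_cases hxΛ : x ∈ Λ
    · exact Or.inr hxΛ
    · exact Or.inl ⟨hx, hxΛ⟩
  let K : W → Set W × Set W := fun x => ({y | y ∈ H ∧ R x y}, {y | y ∈ H ∧ R y x})
  have hK1 : ∀ x y, K x = K y → ∀ z ∈ H, R x z → R y z := by
    intro x y hxy z hz hxz
    have : z ∈ (K x).1 := ⟨hz, hxz⟩
    rw [hxy] at this
    exact this.2
  have hK2 : ∀ x y, K x = K y → ∀ z ∈ H, R z x → R z y := by
    intro x y hxy z hz hxz
    have : z ∈ (K x).2 := ⟨hz, hxz⟩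
    rw [hxy] at this
    exact this.2
  have hanti : ∀ x ∈ Λ, ∀ y ∈ Λ, R x y → x = y := by
    intro x hx y hy hxy
    by_contra hne
    have := h.dec x hx.1 y hy.1 hxy hne
    have h1 := hx.2
    have h2 := hy.2
    omega
  have hall : ∀ x ∈ Q, R x x → ∀ y ∈ Q, R y y := by
    intro x hx hxx
    rcases h.hom with h1 | h1
    · exact h1
    · exact absurd hxx (h1 x hx)
  obtain ⟨ρ, hρ1, hρ2⟩ := exists_rep Λ K
  let T : Set (Set W × Set W) := (𝒫 H) ×ˢ (𝒫 H)
  have hTf : T.Finite := hHf.powerset.prod hHf.powerset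
  have hTc : T.ncard ≤ 2 ^ M * 2 ^ M := by
    rw [Set.ncard_prod, Set.ncard_powerset H hHf]
    have : 2 ^ H.ncard ≤ 2 ^ M := Nat.pow_le_pow_right (by norm_num) hM
    exact Nat.mul_le_mul this this
  have hKT : ∀ x, K x ∈ T := fun x => ⟨fun y hy => hy.1, fun y hy => hy.1⟩
  have hΛc : (2 ^ M * 2 ^ M) * (N + 2) < Λ.ncard := by
    have h1 : Q.ncard ≤ H.ncard + Λ.ncard := by
      refine le_trans (Set.ncard_le_ncard (t := H ∪ Λ) ?_ (hHf.union hΛf)) (Set.ncard_union_le _ _)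
      intro x hx; exact hdich x hx
    omega
  obtain ⟨t, -, htc⟩ := Finset.exists_lt_card_fiber_of_mul_lt_card_of_maps_to
    (s := hΛf.toFinset) (t := hTf.toFinset) (f := K) (n := N + 2)
    (fun x _ => by simpa using hKT x) (by
      rw [← Set.ncard_eq_toFinset_card _ hTf, ← Set.ncard_eq_toFinset_card _ hΛf]
      exact lt_of_le_of_lt (Nat.mul_le_mul_right _ hTc) hΛc)
  let X : Set W := {x | x ∈ Λ ∧ K x = t}
  have hXf : X.Finite := hΛf.subset (fun x hx => hx.1)
  have hXc : N + 2 < X.ncard := by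
    refine lt_of_lt_of_le htc ?_
    rw [← Set.ncard_coe_finset]
    apply Set.ncard_le_ncard _ hXf
    intro x hx
    simpa [X] using hx
  obtain ⟨x0, hx0⟩ : X.Nonempty := by
    rw [← Set.ncard_pos hXf]; omega
  let A : Set W := X \ {ρ x0}
  have hAf : A.Finite := hXf.subset (fun x hx => hx.1)
  have hAc : N + 2 ≤ A.ncard := by
    have := Set.ncard_le_ncard_sdiff_add_ncard X {ρ x0} (Set.finite_singleton _)
    rw [Set.ncard_singleton] at this
    show N + 2 ≤ (X \ {ρ x0}).ncard
    omega
  let E : Set W := H ∪ ρ '' Λ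
  have hEA : (E ∪ A) \ A = E := by
    ext z
    constructor
    · rintro ⟨h1 | h1, h2⟩
      · exact h1
      · exact absurd h1 h2
    · intro hz
      refine ⟨Or.inl hz, ?_⟩
      rintro ⟨⟨h1, h2⟩, h3⟩
      rcases hz with hz | ⟨y, hy, rfl⟩
      · exact hz.2 h1
      · apply h3
        apply hρ2 y hy x0 hx0.1
        rw [hx0.2, ← h2, (hρ1 y hy).2]
  have hEc : E.ncard ≤ M + 2 ^ M * 2 ^ M := by
    refine le_trans (Set.ncard_union_le _ _) (Nat.add_le_add hM (le_trans ?_ hTc))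
    refine Set.ncard_le_ncard_of_injOn K (fun x _ => hKT x) ?_ hTf
    rintro _ ⟨x, hx, rfl⟩ _ ⟨y, hy, rfl⟩ hxy
    rw [(hρ1 x hx).2, (hρ1 y hy).2] at hxy
    exact hρ2 x hx y hy hxy
  have hEQ : E ⊆ Q := by
    rintro x (hx | ⟨y, hy, rfl⟩)
    · exact hx.1
    · exact (hρ1 y hy).1.1
  have hrH : r ∈ H := by
    rcases hdich r h.rQ with h1 | h1
    · exact h1
    · exfalso
      obtain ⟨a, ha, har⟩ := Set.exists_ne_of_one_lt_ncard (s := A) (by omega) r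
      rcases h.root a ha.1.1.1 with h2 | h2
      · exact har h2
      · exact har (hanti r h1 a ha.1.1 h2).symm
  refine ⟨A, E, ⟨?_, Set.subset_union_right, ?_, ?_, ?_, ?_⟩, Or.inl (Or.inl hrH), ?_⟩
  · exact (h.fin.subset hEQ).union hAf
  · rw [← Set.ncard_pos hAf]; omega
  · rw [hEA]; exact hEc
  · rintro X' hX' ⟨a, ha⟩
    refine ⟨a, ha, fun y hy b hb hyb => ?_⟩
    have hyQ : y ∈ Q := by
      rcases hy with hy | hy
      · exact hEQ hy
      · exact hy.1.1.1
    rcases hdich y hyQ with h1 | h1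
    · right
      exact hK2 b a ((hX' hb).1.2.trans (hX' ha).1.2.symm) y h1 hyb
    · left
      exact (hanti y h1 b (hX' hb).1.1 hyb).symm
  · rintro A' hA' -
    rw [hEA]
    let g : W → W := fun x => if x ∈ H ∪ A' then x else ρ x
    have gH : ∀ x ∈ H, g x = x := fun x hx => if_pos (Or.inl hx)
    have gA : ∀ x ∈ A', g x = x := fun x hx => if_pos (Or.inr hx)
    have gΛ : ∀ x ∈ Λ, g x ∈ Λ ∧ K (g x) = K x ∧ g x ∈ E ∪ A' := fun x hx => by
      by_cases hxA : x ∈ A'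
      · rw [gA x hxA]; exact ⟨hx, rfl, Or.inr hxA⟩
      · have : g x = ρ x := if_neg (fun h' => h'.elim (fun h1 => h1.2 hx) hxA)
        rw [this]
        exact ⟨(hρ1 x hx).1, (hρ1 x hx).2, Or.inl (Or.inr ⟨x, hx, rfl⟩)⟩
    have gv : ∀ v ∈ E ∪ A', g v = v := by
      rintro v ((hv | ⟨y, hy, rfl⟩) | hv)
      · exact gH v hv
      · by_cases hvA : ρ y ∈ H ∪ A'
        · exact if_pos hvA
        · have : g (ρ y) = ρ (ρ y) := if_neg hvA
          rw [this]
          exact hρ2 _ (hρ1 y hy).1 _ hy (hρ1 y hy).2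
      · exact gA v hv
    have hvQ : ∀ v ∈ E ∪ A', v ∈ Q := by
      rintro v (hv | hv)
      · exact hEQ hv
      · exact (hA' hv).1.1.1
    have hpm : PM R Q R (E ∪ A') g := by
      refine ⟨?_, ?_, ?_⟩
      · intro x hx
        rcases hdich x hx with h1 | h1
        · rw [gH x h1]; exact Or.inl (Or.inl h1)
        · exact (gΛ x h1).2.2
      · intro x hx y hy hxy
        rcases hdich x hx with h1 | h1
        · rw [gH x h1]
          rcases hdich y hy with h2 | h2
          · rw [gH y h2]; exact hxy
          · exact hK2 y _ (gΛ y h2).2.1.symm x h1 hxy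
        · rcases hdich y hy with h2 | h2
          · rw [gH y h2]
            exact hK1 x _ (gΛ x h1).2.1.symm y h2 hxy
          · obtain rfl := hanti x h1 y h2 hxy
            exact hall x hx hxy _ (gΛ x h1).1.1
      · intro x hx v hv hxv
        rcases hdich x hx with h1 | h1
        · rw [gH x h1] at hxv
          exact ⟨v, hvQ v hv, hxv, gv v hv⟩
        · rcases hdich v (hvQ v hv) with h2 | h2
          · exact ⟨v, hvQ v hv, hK1 _ x (gΛ x h1).2.1 v h2 hxv, gv v hv⟩
          · have he := hanti _ (gΛ x h1).1 v h2 hxv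
            subst he
            exact ⟨x, hx, hall _ (hvQ _ hv) hxv x hx, rfl⟩
    exact hpm.vl (fun v hv => ⟨v, hvQ v hv, gv v hv⟩) h.vl
  · obtain ⟨y, hy, hy'⟩ := exists_fin_inj (N := N) hAf (by omega)
    refine ⟨y, hy, fun i => ⟨Or.inr (hy' i), ?_⟩⟩
    rcases h.root (y i) (hy' i).1.1.1 with h1 | h1
    · exact absurd (hy' i).1.1 (h1 ▸ hrH.2)
    · exact h1

theorem wide_of_PO {L : Set (MForm ℕ)} {d : ℕ}
    (h : ∀ N : ℕ, ∃ (W : Type) (R : W → W → Prop) (Q : Set W) (r : W) (l : W → ℕ), PO L d R Q r l ∧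
      N < Q.ncard) : Wide L := by
  let P : ℕ → Prop := fun k => ∃ B, ∀ N : ℕ, ∃ (W : Type) (R : W → W → Prop) (Q : Set W) (r : W)
    (l : W → ℕ), PO L d R Q r l ∧ {x | x ∈ Q ∧ l x < k}.ncard ≤ B ∧ N < Q.ncard
  have hP0 : P 0 := by
    refine ⟨0, fun N => ?_⟩
    obtain ⟨W, R, Q, r, l, h1, h2⟩ := h N
    exact ⟨W, R, Q, r, l, h1, by simp, h2⟩
  have hPd : ¬ P d := by
    rintro ⟨B, hB⟩
    obtain ⟨W, R, Q, r, l, h1, h2, h3⟩ := hB B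
    have : {x | x ∈ Q ∧ l x < d} = Q := by
      ext x; exact ⟨fun hx => hx.1, fun hx => ⟨hx, h1.bd x hx⟩⟩
    rw [this] at h2
    omega
  obtain ⟨k, hk, hk'⟩ : ∃ k, P k ∧ ¬ P (k + 1) := by
    by_contra hcon
    push Not at hcon
    have : ∀ k, P k := fun k => by
      induction k with
      | zero => exact hP0
      | succ k ih => exact hcon k ih
    exact hPd (this d)
  obtain ⟨B, hB⟩ := hk
  have hM : ∃ M : ℕ, ∀ (W : Type) (R : W → W → Prop) (Q : Set W) (r : W) (l : W → ℕ), PO L d R Q r l →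
      {x | x ∈ Q ∧ l x < k + 1}.ncard ≤ B + 2 ^ B → Q.ncard ≤ M := by
    by_contra hcon
    push Not at hcon
    apply hk'
    refine ⟨B + 2 ^ B, fun N => ?_⟩
    exact hcon N
  obtain ⟨M, hM⟩ := hM
  refine ⟨M + 2 ^ M * 2 ^ M, fun N => ?_⟩
  obtain ⟨W, R, Q, r, l, h1, h2, h3⟩ := hB (M + (2 ^ M * 2 ^ M) * (N + 2))
  obtain ⟨R', Q', r', h4, h5, h6⟩ := po_collapse h1 h2
  obtain ⟨A, E, h7, h8, h9⟩ := po_kf (N := N) h1 (le_trans h6 (hM W R' Q' r' l h4 h5)) h3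
  exact ⟨W, R, E ∪ A, A, r, h7, h8, h9⟩

theorem wide_S4 {L : Set (MForm ℕ)} (hL : IsNormal L) (hnt : ¬ Tabular L) (h : S4log ⊆ L) :
    Wide L := by
  have hT := ax_T h
  have h4 := ax_4 (Or.inl h)
  by_cases hd : ∀ d, ∃ x : CW L, ¬ Dle (CR L) d x
  · exact wide_S4_chain hL h4 hT hd
  push Not at hd
  obtain ⟨d, hd⟩ := hd
  by_cases hc : ∀ N : ℕ, ∃ (W : Type) (R : W → W → Prop) (c : W), Finite W ∧ VL R Set.univ L ∧
      N < {y | R c y ∧ R y c}.ncard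
  · exact wide_of_clusters h4 hT hc
  push Not at hc
  obtain ⟨B, hB⟩ := hc
  exact wide_of_PO (po_of_clusters h4 hT hB (fd hL h4 hd hnt))

theorem Dle_of_bx {L : Set (MForm ℕ)} (d : ℕ) : ∀ x : CW L, bx d x → Dle (CR L) d x := by
  induction d with
  | zero => intro x h; exact h
  | succ d ih => intro x h y hy _; exact ih y (h y hy)

theorem wide_GL {L : Set (MForm ℕ)} (hL : IsNormal L) (hnt : ¬ Tabular L) (h : GLlog ⊆ L) :
    Wide L := by
  have hlob := ax_lob h
  have h4 := ax_4 (Or.inr h)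
  by_cases hd : ∀ d, ∃ x : CW L, ¬ bx d x
  · exact wide_GL_chain hL hlob hd
  push Not at hd
  obtain ⟨d, hd⟩ := hd
  exact wide_of_PO (po_of_irrefl h4 hlob (fd hL h4 (fun x => Dle_of_bx d x (hd x)) hnt))

/-- every pre-tabular normal modal logic containing S4 or containing GL has
both the poly-size model property and the exponential growth property. -/
theorem stmt17 (L : Set (MForm ℕ)) (hnorm : IsNormal L) (hpre : Pretabular L)
    (hcont : S4log ⊆ L ∨ GLlog ⊆ L) :
    PSMP L ∧ EGP L := by
  apply master hpre (ax_4 hcont)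
  rcases hcont with h | h
  · exact wide_S4 hnorm hpre.2.1 h
  · exact wide_GL hnorm hpre.2.1 h
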